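/- (Main Theorem 1: exotic structure on the E₈-singularity.) For every z in the upper half-plane ℍ, writing Φ_j = Φ_j(x(z)) where x(z) = (x₁(z),...,x₆(z)) is the vector of eta-multiplied theta constants of order 13, one has Φ₂₀³ − Φ₃₀² = 1728·Φ₁₂⁵ and Φ₂₀³ − Φ₁₂²·Φ₁₈² = 1728·Φ₁₂⁵. -/

import Mathlib

noncomputable section

open Complex

def ζ : ℂ := Complex.exp (2 * Real.pi * Complex.I / 13)

def AA0 (v : Fin 6 → ℂ) : ℂ := v 0 * v 3 + v 1 * v 4 + v 2 * v 5
def AA1 (v : Fin 6 → ℂ) : ℂ := (v 0) ^ 2 - 2 * v 2 * v 3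
def AA2 (v : Fin 6 → ℂ) : ℂ := -(v 4) ^ 2 - 2 * v 1 * v 3
def AA3 (v : Fin 6 → ℂ) : ℂ := (v 1) ^ 2 - 2 * v 0 * v 4
def AA4 (v : Fin 6 → ℂ) : ℂ := (v 2) ^ 2 - 2 * v 1 * v 5
def AA5 (v : Fin 6 → ℂ) : ℂ := -(v 3) ^ 2 - 2 * v 0 * v 5
def AA6 (v : Fin 6 → ℂ) : ℂ := -(v 5) ^ 2 - 2 * v 2 * v 4

def DD0 (v : Fin 6 → ℂ) : ℂ := v 0 * v 1 * v 2
def DD1 (v : Fin 6 → ℂ) : ℂ := 2 * v 1 * (v 2) ^ 2 + (v 1) ^ 2 * v 5 - (v 3) ^ 2 * v 4 + v 0 * v 4 * v 5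
def DD2 (v : Fin 6 → ℂ) : ℂ := -(v 5) ^ 3 + (v 1) ^ 2 * v 3 - 2 * v 1 * (v 4) ^ 2 + v 0 * v 3 * v 4 + 3 * v 2 * v 4 * v 5
def DD3 (v : Fin 6 → ℂ) : ℂ := 2 * v 0 * (v 1) ^ 2 + (v 0) ^ 2 * v 4 - v 3 * (v 5) ^ 2 + v 2 * v 3 * v 4
def DD4 (v : Fin 6 → ℂ) : ℂ := -(v 1) ^ 2 * v 2 + v 0 * (v 5) ^ 2 - 2 * (v 3) ^ 2 * v 5 - v 0 * v 2 * v 4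
def DD5 (v : Fin 6 → ℂ) : ℂ := -(v 3) ^ 3 + (v 2) ^ 2 * v 4 - 2 * v 2 * (v 5) ^ 2 + v 1 * v 4 * v 5 + 3 * v 0 * v 3 * v 5
def DD6 (v : Fin 6 → ℂ) : ℂ := -(v 4) ^ 3 + (v 0) ^ 2 * v 5 - 2 * v 0 * (v 3) ^ 2 + v 2 * v 3 * v 5 + 3 * v 1 * v 3 * v 4
def DD7 (v : Fin 6 → ℂ) : ℂ := -(v 1) ^ 3 + v 2 * (v 3) ^ 2 - v 0 * v 2 * v 5 - 3 * v 0 * v 1 * v 4 + 2 * (v 0) ^ 2 * v 3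
def DD8 (v : Fin 6 → ℂ) : ℂ := -(v 0) ^ 3 + v 1 * (v 5) ^ 2 - v 1 * v 2 * v 4 - 3 * v 0 * v 2 * v 3 + 2 * (v 2) ^ 2 * v 5
def DD9 (v : Fin 6 → ℂ) : ℂ := 2 * (v 0) ^ 2 * v 2 + (v 2) ^ 2 * v 3 - (v 4) ^ 2 * v 5 + v 1 * v 3 * v 5
def DD10 (v : Fin 6 → ℂ) : ℂ := -(v 0) * (v 2) ^ 2 + v 1 * (v 3) ^ 2 - 2 * v 3 * (v 4) ^ 2 - v 0 * v 1 * v 5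
def DD11 (v : Fin 6 → ℂ) : ℂ := -(v 2) ^ 3 + v 0 * (v 4) ^ 2 - v 0 * v 1 * v 3 - 3 * v 1 * v 2 * v 5 + 2 * (v 1) ^ 2 * v 4
def DD12 (v : Fin 6 → ℂ) : ℂ := -(v 0) ^ 2 * v 1 + v 2 * (v 4) ^ 2 - 2 * v 4 * (v 5) ^ 2 - v 1 * v 2 * v 3
def DDinf (v : Fin 6 → ℂ) : ℂ := v 3 * v 4 * v 5

def GG0 (v : Fin 6 → ℂ) : ℂ := (DD0 v) ^ 2 + (DDinf v) ^ 2
def GG1 (v : Fin 6 → ℂ) : ℂ := -(DD7 v) ^ 2 + 2 * DD0 v * DD1 v + 10 * DDinf v * DD1 v + 2 * DD2 v * DD12 v - 2 * DD3 v * DD11 v - 4 * DD4 v * DD10 v - 2 * DD9 v * DD5 v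
def GG2 (v : Fin 6 → ℂ) : ℂ := -2 * (DD1 v) ^ 2 - 4 * DD0 v * DD2 v + 6 * DDinf v * DD2 v - 2 * DD4 v * DD11 v + 2 * DD5 v * DD10 v - 2 * DD6 v * DD9 v - 2 * DD7 v * DD8 v
def GG3 (v : Fin 6 → ℂ) : ℂ := -(DD8 v) ^ 2 + 2 * DD0 v * DD3 v + 10 * DDinf v * DD3 v + 2 * DD6 v * DD10 v - 2 * DD9 v * DD7 v - 4 * DD12 v * DD4 v - 2 * DD1 v * DD2 v
def GG4 (v : Fin 6 → ℂ) : ℂ := -(DD2 v) ^ 2 + 10 * DD0 v * DD4 v - 2 * DDinf v * DD4 v + 2 * DD5 v * DD12 v - 2 * DD9 v * DD8 v - 4 * DD1 v * DD3 v - 2 * DD10 v * DD7 v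
def GG5 (v : Fin 6 → ℂ) : ℂ := -2 * (DD9 v) ^ 2 - 4 * DD0 v * DD5 v + 6 * DDinf v * DD5 v - 2 * DD10 v * DD8 v + 2 * DD6 v * DD12 v - 2 * DD2 v * DD3 v - 2 * DD11 v * DD7 v
def GG6 (v : Fin 6 → ℂ) : ℂ := -2 * (DD3 v) ^ 2 - 4 * DD0 v * DD6 v + 6 * DDinf v * DD6 v - 2 * DD12 v * DD7 v + 2 * DD2 v * DD4 v - 2 * DD5 v * DD1 v - 2 * DD8 v * DD11 v
def GG7 (v : Fin 6 → ℂ) : ℂ := -2 * (DD10 v) ^ 2 + 6 * DD0 v * DD7 v + 4 * DDinf v * DD7 v - 2 * DD1 v * DD6 v - 2 * DD2 v * DD5 v - 2 * DD8 v * DD12 v - 2 * DD9 v * DD11 v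
def GG8 (v : Fin 6 → ℂ) : ℂ := -2 * (DD4 v) ^ 2 + 6 * DD0 v * DD8 v + 4 * DDinf v * DD8 v - 2 * DD3 v * DD5 v - 2 * DD6 v * DD2 v - 2 * DD11 v * DD10 v - 2 * DD1 v * DD7 v
def GG9 (v : Fin 6 → ℂ) : ℂ := -(DD11 v) ^ 2 + 2 * DD0 v * DD9 v + 10 * DDinf v * DD9 v + 2 * DD5 v * DD4 v - 2 * DD1 v * DD8 v - 4 * DD10 v * DD12 v - 2 * DD3 v * DD6 v
def GG10 (v : Fin 6 → ℂ) : ℂ := -(DD5 v) ^ 2 + 10 * DD0 v * DD10 v - 2 * DDinf v * DD10 v + 2 * DD6 v * DD4 v - 2 * DD3 v * DD7 v - 4 * DD9 v * DD1 v - 2 * DD12 v * DD11 v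
def GG11 (v : Fin 6 → ℂ) : ℂ := -2 * (DD12 v) ^ 2 + 6 * DD0 v * DD11 v + 4 * DDinf v * DD11 v - 2 * DD9 v * DD2 v - 2 * DD5 v * DD6 v - 2 * DD7 v * DD4 v - 2 * DD3 v * DD8 v
def GG12 (v : Fin 6 → ℂ) : ℂ := -(DD6 v) ^ 2 + 10 * DD0 v * DD12 v - 2 * DDinf v * DD12 v + 2 * DD2 v * DD10 v - 2 * DD1 v * DD11 v - 4 * DD3 v * DD9 v - 2 * DD4 v * DD8 v

def wInf (v : Fin 6 → ℂ) : ℂ := 13 * (AA0 v) ^ 2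
def wF (ν : ℕ) (v : Fin 6 → ℂ) : ℂ :=
  (AA0 v + ζ ^ ν * AA1 v + ζ ^ (4 * ν) * AA2 v + ζ ^ (9 * ν) * AA3 v + ζ ^ (3 * ν) * AA4 v
    + ζ ^ (12 * ν) * AA5 v + ζ ^ (10 * ν) * AA6 v) ^ 2
def dInf (v : Fin 6 → ℂ) : ℂ := 13 ^ 2 * GG0 v
def dF (ν : ℕ) (v : Fin 6 → ℂ) : ℂ :=
  -13 * GG0 v + ζ ^ ν * GG1 v + ζ ^ (2 * ν) * GG2 v + ζ ^ (3 * ν) * GG3 v + ζ ^ (4 * ν) * GG4 v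
    + ζ ^ (5 * ν) * GG5 v + ζ ^ (6 * ν) * GG6 v + ζ ^ (7 * ν) * GG7 v + ζ ^ (8 * ν) * GG8 v
    + ζ ^ (9 * ν) * GG9 v + ζ ^ (10 * ν) * GG10 v + ζ ^ (11 * ν) * GG11 v + ζ ^ (12 * ν) * GG12 v

def Phi12 (v : Fin 6 → ℂ) : ℂ :=
  -(1 / (13 * 52) : ℂ) * ((∑ ν ∈ Finset.range 13, (dF ν v) ^ 2) + (dInf v) ^ 2)
def Phi18 (v : Fin 6 → ℂ) : ℂ :=
  (1 / (13 * 6) : ℂ) * ((∑ ν ∈ Finset.range 13, (dF ν v) ^ 3) + (dInf v) ^ 3)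
def Phi30 (v : Fin 6 → ℂ) : ℂ :=
  -(1 / (13 * 1315) : ℂ) * ((∑ ν ∈ Finset.range 13, (dF ν v) ^ 5) + (dInf v) ^ 5)
def Phi42 (v : Fin 6 → ℂ) : ℂ :=
  (1 / (13 * 226842) : ℂ) * ((∑ ν ∈ Finset.range 13, (dF ν v) ^ 7) + (dInf v) ^ 7)

def Phi20 (v : Fin 6 → ℂ) : ℂ :=
  (1 / (13 * 25) : ℂ) * ((∑ ν ∈ Finset.range 13, (wF ν v) ^ 5) + (wInf v) ^ 5)
def Phi32 (v : Fin 6 → ℂ) : ℂ :=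
  -(1 / (13 * 1840) : ℂ) * ((∑ ν ∈ Finset.range 13, (wF ν v) ^ 8) + (wInf v) ^ 8)
def Phi44 (v : Fin 6 → ℂ) : ℂ :=
  (1 / (13 * 146905) : ℂ) * ((∑ ν ∈ Finset.range 13, (wF ν v) ^ 11) + (wInf v) ^ 11)

def th13 (c : ℚ) (k : ℤ) (z : ℂ) : ℂ :=
  Complex.exp (2 * Real.pi * Complex.I * (c : ℂ) * z) *
    ∑' n : ℤ, (-1 : ℂ) ^ n *
      Complex.exp (2 * Real.pi * Complex.I * (((13 * n ^ 2 + k * n : ℤ) : ℂ) / 2) * z)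

def ta : Fin 6 → ℂ → ℂ :=
  ![th13 (121 / 104) 11, th13 (49 / 104) 7, th13 (25 / 104) 5,
    fun z => -th13 (9 / 104) 3 z, th13 (81 / 104) 9, th13 (1 / 104) 1]

def AV (z : ℂ) : Fin 6 → ℂ := fun i => ta i z

def etaF (z : ℂ) : ℂ :=
  Complex.exp (2 * Real.pi * Complex.I * z / 24) *
    ∏' n : ℕ, (1 - Complex.exp (2 * Real.pi * Complex.I * z) ^ (n + 1))

def xV (z : ℂ) : Fin 6 → ℂ := fun i => etaF z * ta i z

def Δfun (z : ℂ) : ℂ := (etaF z) ^ 24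

def Eis (k : ℕ) (z : ℂ) : ℂ :=
  (1 / 2 : ℂ) * ∑' p : {p : ℤ × ℤ // Int.gcd p.1 p.2 = 1},
    1 / ((p.val.1 : ℂ) * z + (p.val.2 : ℂ)) ^ k

/-- Relations between the entries of the finite Fourier matrix (rows `a`, `c`) and the coefficients
`A, ..., G` of the transformed cubic `DD0`: the coefficients of `DD0` after the substitution. -/
structure PeriodRel (a1 a2 a3 c1 c2 c3 A B C D E G : ℂ) : Prop where
  coeff_000 : a1 * a2 * a3 = G
  coeff_001 : a1 ^ 2 * a2 + a1 * a3 ^ 2 + a2 ^ 2 * a3 = D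
  coeff_002 : a1 ^ 2 * a3 + a1 * a2 ^ 2 + a2 * a3 ^ 2 = 2 * C
  coeff_003 : a1 * a2 * c3 + a1 * a3 * c2 + a2 * a3 * c1 = -2 * G
  coeff_004 : a1 * a2 * c1 + a1 * a3 * c3 + a2 * a3 * c2 = C
  coeff_005 : a1 * a2 * c2 + a1 * a3 * c1 + a2 * a3 * c3 = E
  coeff_012 : a1 ^ 3 + 3 * a1 * a2 * a3 + a2 ^ 3 + a3 ^ 3 = A
  coeff_013 : a1 ^ 2 * c2 + a1 * a2 * c1 + a1 * a3 * c3 + a2 ^ 2 * c3 + a2 * a3 * c2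
      + a3 ^ 2 * c1 = G
  coeff_014 : a1 ^ 2 * c3 + a1 * a2 * c2 + a1 * a3 * c1 + a2 ^ 2 * c1 + a2 * a3 * c3
      + a3 ^ 2 * c2 = 3 * G
  coeff_015 : a1 ^ 2 * c1 + a1 * a2 * c3 + a1 * a3 * c2 + a2 ^ 2 * c2 + a2 * a3 * c1
      + a3 ^ 2 * c3 = D
  coeff_033 : a1 * c2 * c3 + a2 * c1 * c3 + a3 * c1 * c2 = -2 * E
  coeff_034 : a1 * c1 * c2 + a1 * c3 ^ 2 + a2 * c1 ^ 2 + a2 * c2 * c3 + a3 * c1 * c3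
      + a3 * c2 ^ 2 = E
  coeff_035 : a1 * c1 * c3 + a1 * c2 ^ 2 + a2 * c1 * c2 + a2 * c3 ^ 2 + a3 * c1 ^ 2
      + a3 * c2 * c3 = 3 * E
  coeff_044 : a1 * c1 * c3 + a2 * c1 * c2 + a3 * c2 * c3 = -G
  coeff_045 : a1 * c1 ^ 2 + a1 * c2 * c3 + a2 * c1 * c3 + a2 * c2 ^ 2 + a3 * c1 * c2
      + a3 * c3 ^ 2 = C
  coeff_055 : a1 * c1 * c2 + a2 * c2 * c3 + a3 * c1 * c3 = -D
  coeff_333 : c1 * c2 * c3 = -E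
  coeff_334 : c1 ^ 2 * c2 + c1 * c3 ^ 2 + c2 ^ 2 * c3 = -C
  coeff_335 : c1 ^ 2 * c3 + c1 * c2 ^ 2 + c2 * c3 ^ 2 = 2 * D
  coeff_345 : c1 ^ 3 + 3 * c1 * c2 * c3 + c2 ^ 3 + c3 ^ 3 = B

theorem PeriodRel.DD0_eq {a1 a2 a3 c1 c2 c3 A B C D E G : ℂ}
    (h : PeriodRel a1 a2 a3 c1 c2 c3 A B C D E G) (v : Fin 6 → ℂ) :
    (a1 * v 0 + a2 * v 1 + a3 * v 2 + c1 * v 3 + c2 * v 4 + c3 * v 5)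
      * (a2 * v 0 + a3 * v 1 + a1 * v 2 + c2 * v 3 + c3 * v 4 + c1 * v 5)
      * (a3 * v 0 + a1 * v 1 + a2 * v 2 + c3 * v 3 + c1 * v 4 + c2 * v 5)
      = A * DD0 v + C * (DD1 v + DD3 v + DD9 v) - D * (DD4 v + DD10 v + DD12 v)
      + E * (DD2 v + DD5 v + DD6 v) - G * (DD7 v + DD8 v + DD11 v) + B * DDinf v := by
  simp only [DD0, DD1, DD2, DD3, DD4, DD5, DD6, DD7, DD8, DD9, DD10, DD11, DD12, DDinf]
  linear_combination (v 0 ^ 3 + v 1 ^ 3 + v 2 ^ 3) * h.coeff_000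
    + (v 0 ^ 2 * v 1 + v 0 * v 2 ^ 2 + v 1 ^ 2 * v 2) * h.coeff_001
    + (v 0 ^ 2 * v 2 + v 0 * v 1 ^ 2 + v 1 * v 2 ^ 2) * h.coeff_002
    + (v 0 ^ 2 * v 3 + v 1 ^ 2 * v 4 + v 2 ^ 2 * v 5) * h.coeff_003
    + (v 0 ^ 2 * v 4 + v 1 ^ 2 * v 5 + v 2 ^ 2 * v 3) * h.coeff_004
    + (v 0 ^ 2 * v 5 + v 1 ^ 2 * v 3 + v 2 ^ 2 * v 4) * h.coeff_005
    + (v 0 * v 1 * v 2) * h.coeff_012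
    + (v 0 * v 1 * v 3 + v 0 * v 2 * v 5 + v 1 * v 2 * v 4) * h.coeff_013
    + (v 0 * v 1 * v 4 + v 0 * v 2 * v 3 + v 1 * v 2 * v 5) * h.coeff_014
    + (v 0 * v 1 * v 5 + v 0 * v 2 * v 4 + v 1 * v 2 * v 3) * h.coeff_015
    + (v 0 * v 3 ^ 2 + v 1 * v 4 ^ 2 + v 2 * v 5 ^ 2) * h.coeff_033
    + (v 0 * v 3 * v 4 + v 1 * v 4 * v 5 + v 2 * v 3 * v 5) * h.coeff_034
    + (v 0 * v 3 * v 5 + v 1 * v 3 * v 4 + v 2 * v 4 * v 5) * h.coeff_035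
    + (v 0 * v 4 ^ 2 + v 1 * v 5 ^ 2 + v 2 * v 3 ^ 2) * h.coeff_044
    + (v 0 * v 4 * v 5 + v 1 * v 3 * v 5 + v 2 * v 3 * v 4) * h.coeff_045
    + (v 0 * v 5 ^ 2 + v 1 * v 3 ^ 2 + v 2 * v 4 ^ 2) * h.coeff_055
    + (v 3 ^ 3 + v 4 ^ 3 + v 5 ^ 3) * h.coeff_333
    + (v 3 ^ 2 * v 4 + v 3 * v 5 ^ 2 + v 4 ^ 2 * v 5) * h.coeff_334
    + (v 3 ^ 2 * v 5 + v 3 * v 4 ^ 2 + v 4 * v 5 ^ 2) * h.coeff_335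
    + (v 3 * v 4 * v 5) * h.coeff_345

theorem PeriodRel.swap {a1 a2 a3 c1 c2 c3 A B C D E G : ℂ}
    (h : PeriodRel a1 a2 a3 c1 c2 c3 A B C D E G) :
    PeriodRel c1 c2 c3 (-a1) (-a2) (-a3) B (-A) D (-C) G (-E) where
  coeff_000 := by linear_combination h.coeff_333
  coeff_001 := by linear_combination h.coeff_334
  coeff_002 := by linear_combination h.coeff_335
  coeff_003 := by linear_combination -h.coeff_033
  coeff_004 := by linear_combination -h.coeff_055
  coeff_005 := by linear_combination -h.coeff_044
  coeff_012 := by linear_combination h.coeff_345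
  coeff_013 := by linear_combination -h.coeff_034
  coeff_014 := by linear_combination -h.coeff_035
  coeff_015 := by linear_combination -h.coeff_045
  coeff_033 := by linear_combination h.coeff_003
  coeff_034 := by linear_combination h.coeff_013
  coeff_035 := by linear_combination h.coeff_014
  coeff_044 := by linear_combination h.coeff_005
  coeff_045 := by linear_combination h.coeff_015
  coeff_055 := by linear_combination h.coeff_004
  coeff_333 := by linear_combination -h.coeff_000
  coeff_334 := by linear_combination -h.coeff_001
  coeff_335 := by linear_combination -h.coeff_002
  coeff_345 := by linear_combination -h.coeff_012

theorem periodRel_of_root {t : ℂ}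
    (ht : 1 + t + t ^ 2 + t ^ 3 + t ^ 4 + t ^ 5 + t ^ 6 + t ^ 7 + t ^ 8 + t ^ 9 + t ^ 10 + t ^ 11
      + t ^ 12 = 0) :
    PeriodRel (t - t ^ 12) (t ^ 3 - t ^ 10) (t ^ 9 - t ^ 4) (t ^ 8 - t ^ 5) (t ^ 11 - t ^ 2) (t ^ 7
        - t ^ 6)
      (-2 * t + 3 * t ^ 2 - 2 * t ^ 3 + 2 * t ^ 4 + 3 * t ^ 5
          + 3 * t ^ 6 - 3 * t ^ 7 - 3 * t ^ 8 - 2 * t ^ 9 + 2 * t ^ 10 - 3 * t ^ 11 + 2 * t ^ 12)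
      (3 * t + 2 * t ^ 2 + 3 * t ^ 3 - 3 * t ^ 4 + 2 * t ^ 5 + 2 * t ^ 6 - 2 * t ^ 7 - 2 * t ^ 8
          + 3 * t ^ 9 - 3 * t ^ 10 - 2 * t ^ 11 - 3 * t ^ 12)
      (-t - t ^ 2 - t ^ 3 + t ^ 4 - t ^ 5 - t ^ 6 + t ^ 7 + t ^ 8 - t ^ 9 + t ^ 10 + t ^ 11
          + t ^ 12)
      (-t + t ^ 2 - t ^ 3 + t ^ 4 + t ^ 5 + t ^ 6 - t ^ 7 - t ^ 8 - t ^ 9 + t ^ 10 - t ^ 11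
          + t ^ 12)
      (-t - t ^ 3 + t ^ 4 - t ^ 9 + t ^ 10 + t ^ 12)
      (t ^ 2 + t ^ 5 + t ^ 6 - t ^ 7 - t ^ 8 - t ^ 11) where
  coeff_000 := by linear_combination (-t ^ 2 + t ^ 3 - t ^ 5 + 2 * t ^ 7 - t ^ 8
      + t ^ 11 - t ^ 12 + t ^ 13 - t ^ 14 - t ^ 18 + t ^ 19) * ht
  coeff_001 := by linear_combination (t - 2 * t ^ 2 + 2 * t ^ 3 - 2 * t ^ 4 + t ^ 5 - t ^ 6
      + 2 * t ^ 7 + t ^ 9 - 4 * t ^ 10 + 3 * t ^ 11 - 3 * t ^ 12 + 2 * t ^ 13 - t ^ 14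
      + t ^ 15 - t ^ 16 + 2 * t ^ 17 - t ^ 18 + t ^ 21 - t ^ 22) * ht
  coeff_002 := by linear_combination (2 * t - 4 * t ^ 4 + 4 * t ^ 5 - t ^ 6 - 2 * t ^ 7 - t ^ 8
      + 4 * t ^ 9 - 4 * t ^ 10 + 2 * t ^ 11 - 2 * t ^ 12 + 2 * t ^ 13 + 2 * t ^ 15 - 2 * t ^ 16
      + t ^ 19 - 2 * t ^ 20 + t ^ 21) * ht
  coeff_003 := by linear_combination (2 * t ^ 2 - 2 * t ^ 3 + 2 * t ^ 5 - 3 * t ^ 7 - t ^ 8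
      + 2 * t ^ 9 - t ^ 10 + t ^ 12 + t ^ 15 - 2 * t ^ 16 + t ^ 17 + t ^ 19 - t ^ 20) * ht
  coeff_004 := by linear_combination (t - 2 * t ^ 4 + 2 * t ^ 5 - 2 * t ^ 7
      + 2 * t ^ 9 - 2 * t ^ 10 + t ^ 11 - t ^ 12 + t ^ 13 + t ^ 15 - t ^ 16) * ht
  coeff_005 := by linear_combination (t - t ^ 2 + t ^ 3 - 2 * t ^ 4 + t ^ 5 - t ^ 6 + t ^ 7
      + t ^ 9 - t ^ 10 - t ^ 12 + 2 * t ^ 13 - t ^ 14 + t ^ 16 - t ^ 17 - t ^ 20 + t ^ 21) * ht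
  coeff_012 := by linear_combination (2 * t - 5 * t ^ 2 + 6 * t ^ 3 - 5 * t ^ 4 - t ^ 5
      + 6 * t ^ 7 - 3 * t ^ 8 + 3 * t ^ 9 - 5 * t ^ 10 + 5 * t ^ 11 - 6 * t ^ 12
      + 6 * t ^ 13 - 4 * t ^ 14 + t ^ 15 + t ^ 17 - 4 * t ^ 18 + 3 * t ^ 19 + t ^ 23 - t ^ 24) * ht
  coeff_013 := by linear_combination (-t ^ 2 + t ^ 3 - t ^ 4 + 2 * t ^ 7 - t ^ 9
      + 2 * t ^ 11 - 3 * t ^ 12 + 2 * t ^ 13 - 2 * t ^ 14 + 2 * t ^ 15 - t ^ 16 - t ^ 22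
      + t ^ 23) * ht
  coeff_014 := by linear_combination (-3 * t ^ 2 + 3 * t ^ 3 - 3 * t ^ 5 - t ^ 6
      + 7 * t ^ 7 - t ^ 8 - t ^ 9 - t ^ 10 + 2 * t ^ 11 - 2 * t ^ 12 + t ^ 13 - t ^ 14 - t ^ 15
      + t ^ 16 + t ^ 17 - 2 * t ^ 18 + t ^ 19 - t ^ 20 + t ^ 21) * ht
  coeff_015 := by linear_combination (t - 2 * t ^ 2 + 2 * t ^ 3 - 2 * t ^ 4 + 2 * t ^ 7 - t ^ 8
      + t ^ 9 - 2 * t ^ 10 + 3 * t ^ 11 - 3 * t ^ 12 + t ^ 13 + t ^ 15 - t ^ 16 - t ^ 18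
      + t ^ 19) * ht
  coeff_033 := by linear_combination (-2 * t + 2 * t ^ 2 - 2 * t ^ 3
      + 4 * t ^ 4 - 2 * t ^ 5 - t ^ 9 + 2 * t ^ 10 - 2 * t ^ 11
      + 3 * t ^ 12 - 2 * t ^ 13 - t ^ 15 + 2 * t ^ 17 - t ^ 18) * ht
  coeff_034 := by linear_combination (t - t ^ 2 + t ^ 3 - 2 * t ^ 4 + t ^ 5 + t ^ 9 - 2 * t ^ 10
      + t ^ 11 - 2 * t ^ 12 + 5 * t ^ 13 - 4 * t ^ 14 + t ^ 15) * ht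
  coeff_035 := by linear_combination (3 * t - 3 * t ^ 2 + 3 * t ^ 3 - 6 * t ^ 4
      + 4 * t ^ 5 - t ^ 6 + 3 * t ^ 9 - 5 * t ^ 10 + 2 * t ^ 11 - 3 * t ^ 12 + 2 * t ^ 13
      + t ^ 14 + t ^ 16 - t ^ 17 + t ^ 21 - t ^ 22) * ht
  coeff_044 := by linear_combination (t ^ 2 - t ^ 3 + t ^ 5 - 2 * t ^ 7 + t ^ 9
      + t ^ 10 - 2 * t ^ 11 + t ^ 12 - t ^ 13 + t ^ 14 + t ^ 16 - t ^ 17) * ht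
  coeff_045 := by linear_combination (t - 2 * t ^ 4 + 2 * t ^ 5 - t ^ 7 - t ^ 8
      + 3 * t ^ 9 - 4 * t ^ 10 + t ^ 11 + t ^ 13 - t ^ 16 + 2 * t ^ 17 - t ^ 18
      + t ^ 19 - t ^ 20) * ht
  coeff_055 := by linear_combination (-t + 2 * t ^ 2 - 2 * t ^ 3 + 2 * t ^ 4 - 2 * t ^ 7
      + t ^ 8 - t ^ 9 + 2 * t ^ 10 - 2 * t ^ 11 + t ^ 12 - t ^ 14 + t ^ 15 + t ^ 18 - t ^ 19) * ht
  coeff_333 := by linear_combination (-t + t ^ 2 - t ^ 3 + 2 * t ^ 4 - t ^ 5 - t ^ 9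
      + 2 * t ^ 10 - t ^ 11 + t ^ 12 - 2 * t ^ 13 + t ^ 14) * ht
  coeff_334 := by linear_combination (-t + 2 * t ^ 4 - 2 * t ^ 5 + 2 * t ^ 7 - 2 * t ^ 9 + t ^ 10
      + 2 * t ^ 11 - 2 * t ^ 12 - t ^ 14 + 2 * t ^ 15 - 2 * t ^ 16 + t ^ 17) * ht
  coeff_335 := by linear_combination (2 * t - 4 * t ^ 2 + 4 * t ^ 3 - 4 * t ^ 4
      + 4 * t ^ 7 - t ^ 9 - 3 * t ^ 10 + 4 * t ^ 11 - 3 * t ^ 12 + t ^ 13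
      + t ^ 14 - t ^ 15 - t ^ 17 + t ^ 18) * ht
  coeff_345 := by linear_combination (-3 * t + t ^ 2 - t ^ 3 + 6 * t ^ 4 - 5 * t ^ 5 - t ^ 6
      + 5 * t ^ 7 - 5 * t ^ 9 + 6 * t ^ 10 - t ^ 11 + t ^ 12 - 6 * t ^ 13 + 3 * t ^ 14 - t ^ 20
      + t ^ 21) * ht

/-- The quadratic analogue of `PeriodRel`, for the form `AA0`. -/
structure QuadPeriodRel (a1 a2 a3 c1 c2 c3 s : ℂ) : Prop where
  sq_sub : c1 ^ 2 + c2 ^ 2 + c3 ^ 2 - a1 ^ 2 - a2 ^ 2 - a3 ^ 2 = s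
  dot : a1 * c1 + a2 * c2 + a3 * c3 = s
  cross : a1 * (c2 + c3) + a2 * (c3 + c1) + a3 * (c1 + c2) = 0
  sym_sub : c1 * c2 + c2 * c3 + c3 * c1 - (a1 * a2 + a2 * a3 + a3 * a1) = -2 * s

theorem QuadPeriodRel.AA0_eq {a1 a2 a3 c1 c2 c3 s : ℂ} (h : QuadPeriodRel a1 a2 a3 c1 c2 c3 s)
    (v : Fin 6 → ℂ) :
    (a1 * v 0 + a2 * v 1 + a3 * v 2 + c1 * v 3 + c2 * v 4 + c3 * v 5)
        * (c1 * v 0 + c2 * v 1 + c3 * v 2 + -a1 * v 3 + -a2 * v 4 + -a3 * v 5) + 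
      (a2 * v 0 + a3 * v 1 + a1 * v 2 + c2 * v 3 + c3 * v 4 + c1 * v 5)
        * (c2 * v 0 + c3 * v 1 + c1 * v 2 + -a2 * v 3 + -a3 * v 4 + -a1 * v 5) + 
      (a3 * v 0 + a1 * v 1 + a2 * v 2 + c3 * v 3 + c1 * v 4 + c2 * v 5)
        * (c3 * v 0 + c1 * v 1 + c2 * v 2 + -a3 * v 3 + -a1 * v 4 + -a2 * v 5)
      = s * (AA0 v + AA1 v + AA2 v + AA3 v + AA4 v + AA5 v + AA6 v) := by
  simp only [AA0, AA1, AA2, AA3, AA4, AA5, AA6]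
  linear_combination (v 0 ^ 2 + v 1 ^ 2 + v 2 ^ 2 - v 3 ^ 2 - v 4 ^ 2 - v 5 ^ 2) * h.dot
    + (v 0 * v 1 + v 1 * v 2 + v 2 * v 0 - v 3 * v 4 - v 4 * v 5 - v 5 * v 3) * h.cross
    + (v 0 * v 3 + v 1 * v 4 + v 2 * v 5) * h.sq_sub
    + (v 0 * v 4 + v 0 * v 5 + v 1 * v 3 + v 1 * v 5 + v 2 * v 3 + v 2 * v 4) * h.sym_sub

theorem quadPeriodRel_of_root {t : ℂ} (ht : 1 + t + t ^ 2 + t ^ 3 + t ^ 4 + t ^ 5 + t ^ 6 + t ^ 7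
    + t ^ 8 + t ^ 9 + t ^ 10 + t ^ 11
      + t ^ 12 = 0) :
    QuadPeriodRel (t - t ^ 12) (t ^ 3 - t ^ 10) (t ^ 9 - t ^ 4) (t ^ 8 - t ^ 5) (t ^ 11 - t ^ 2) (t
        ^ 7 - t ^ 6)
      (1 + 2 * (t + t ^ 3 + t ^ 4 + t ^ 9 + t ^ 10 + t ^ 12)) where
  sq_sub := by linear_combination (-1 - t + t ^ 2 - t ^ 3 + t ^ 4 + t ^ 5 - t ^ 6
      + t ^ 7 - t ^ 8 - t ^ 9 + t ^ 10 + t ^ 11 - t ^ 12) * ht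
  dot := by linear_combination (-1 - t + 2 * t ^ 2 - 2 * t ^ 3 + t ^ 5 + t ^ 7 - t ^ 9) * ht
  cross := by linear_combination (-t ^ 3 + t ^ 4 + t ^ 6 - 2 * t ^ 7 + t ^ 8 + t ^ 10 - t ^ 11) * ht
  sym_sub := by linear_combination (2 + 2 * t - 4 * t ^ 2 + 4 * t ^ 3 - t ^ 4 - 2 * t ^ 5 - t ^ 6
      + 2 * t ^ 7 - t ^ 8 + 2 * t ^ 9 - t ^ 10) * ht

theorem gauss_period_sq {t : ℂ} (ht : 1 + t + t ^ 2 + t ^ 3 + t ^ 4 + t ^ 5 + t ^ 6 + t ^ 7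
    + t ^ 8 + t ^ 9 + t ^ 10 + t ^ 11
      + t ^ 12 = 0) :
    (1 + 2 * (t + t ^ 3 + t ^ 4 + t ^ 9 + t ^ 10 + t ^ 12)) ^ 2 = 13 := by
  linear_combination (-12 + 16 * t + 8 * t ^ 4 - 4 * t ^ 5 - 4 * t ^ 6 + 4 * t ^ 7 - 4 * t ^ 8
      + 8 * t ^ 10 - 4 * t ^ 11 + 4 * t ^ 12) * ht

/-- Inner products between the coefficients `A, ..., G` of the transformed cubics. -/
structure PeriodInner (A B C D E G : ℂ) : Prop where
  AB : A ^ 2 + B ^ 2 = -169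
  AC : A * C + B * D = 13
  BC : B * C - A * D = 65
  AE : A * E + B * G = -26
  BE : B * E - A * G = 39
  CD : C ^ 2 + D ^ 2 = -26
  CE : C * E + D * G = -13
  DE : D * E - C * G = -13
  EG : E ^ 2 + G ^ 2 = -13

theorem periodInner_of_root {t : ℂ} (ht : 1 + t + t ^ 2 + t ^ 3 + t ^ 4 + t ^ 5 + t ^ 6 + t ^ 7
    + t ^ 8 + t ^ 9 + t ^ 10 + t ^ 11
      + t ^ 12 = 0) :
    PeriodInner
      (-2 * t + 3 * t ^ 2 - 2 * t ^ 3 + 2 * t ^ 4 + 3 * t ^ 5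
          + 3 * t ^ 6 - 3 * t ^ 7 - 3 * t ^ 8 - 2 * t ^ 9 + 2 * t ^ 10 - 3 * t ^ 11 + 2 * t ^ 12)
      (3 * t + 2 * t ^ 2 + 3 * t ^ 3 - 3 * t ^ 4 + 2 * t ^ 5 + 2 * t ^ 6 - 2 * t ^ 7 - 2 * t ^ 8
          + 3 * t ^ 9 - 3 * t ^ 10 - 2 * t ^ 11 - 3 * t ^ 12)
      (-t - t ^ 2 - t ^ 3 + t ^ 4 - t ^ 5 - t ^ 6 + t ^ 7 + t ^ 8 - t ^ 9 + t ^ 10 + t ^ 11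
          + t ^ 12)
      (-t + t ^ 2 - t ^ 3 + t ^ 4 + t ^ 5 + t ^ 6 - t ^ 7 - t ^ 8 - t ^ 9 + t ^ 10 - t ^ 11
          + t ^ 12)
      (-t - t ^ 3 + t ^ 4 - t ^ 9 + t ^ 10 + t ^ 12)
      (t ^ 2 + t ^ 5 + t ^ 6 - t ^ 7 - t ^ 8 - t ^ 11) where
  AB := by linear_combination (169 - 169 * t + 13 * t ^ 2 - 13 * t ^ 3 + 39 * t ^ 4 - 65 * t ^ 5
      + 39 * t ^ 6 - 13 * t ^ 7 + 39 * t ^ 8 - 65 * t ^ 9 + 39 * t ^ 10 - 13 * t ^ 11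
      + 13 * t ^ 12) * ht
  AC := by linear_combination (-13 + 13 * t - t ^ 2 + t ^ 3 - 3 * t ^ 4 + 5 * t ^ 5 - 3 * t ^ 6
      + t ^ 7 - 3 * t ^ 8 + 5 * t ^ 9 - 3 * t ^ 10 + t ^ 11 - t ^ 12) * ht
  BC := by linear_combination (-65 + 65 * t - 5 * t ^ 2 + 5 * t ^ 3 - 15 * t ^ 4
      + 25 * t ^ 5 - 15 * t ^ 6 + 5 * t ^ 7 - 15 * t ^ 8 + 25 * t ^ 9 - 15 * t ^ 10
      + 5 * t ^ 11 - 5 * t ^ 12) * ht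
  AE := by linear_combination (26 - 26 * t + 2 * t ^ 2 - 2 * t ^ 3 + 6 * t ^ 4 - 10 * t ^ 5
      + 6 * t ^ 6 - 2 * t ^ 7 + 6 * t ^ 8 - 10 * t ^ 9 + 6 * t ^ 10 - 2 * t ^ 11 + 2 * t ^ 12) * ht
  BE := by linear_combination (-39 + 39 * t - 3 * t ^ 2 + 3 * t ^ 3 - 9 * t ^ 4
      + 15 * t ^ 5 - 9 * t ^ 6 + 3 * t ^ 7 - 9 * t ^ 8 + 15 * t ^ 9 - 9 * t ^ 10
      + 3 * t ^ 11 - 3 * t ^ 12) * ht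
  CD := by linear_combination (26 - 26 * t + 2 * t ^ 2 - 2 * t ^ 3 + 6 * t ^ 4 - 10 * t ^ 5
      + 6 * t ^ 6 - 2 * t ^ 7 + 6 * t ^ 8 - 10 * t ^ 9 + 6 * t ^ 10 - 2 * t ^ 11 + 2 * t ^ 12) * ht
  CE := by linear_combination (13 - 13 * t + t ^ 2 - t ^ 3 + 3 * t ^ 4 - 5 * t ^ 5
      + 3 * t ^ 6 - t ^ 7 + 3 * t ^ 8 - 5 * t ^ 9 + 3 * t ^ 10 - t ^ 11 + t ^ 12) * ht
  DE := by linear_combination (13 - 13 * t + t ^ 2 - t ^ 3 + 3 * t ^ 4 - 5 * t ^ 5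
      + 3 * t ^ 6 - t ^ 7 + 3 * t ^ 8 - 5 * t ^ 9 + 3 * t ^ 10 - t ^ 11 + t ^ 12) * ht
  EG := by linear_combination (13 - 13 * t + t ^ 2 - t ^ 3 + 3 * t ^ 4 - 5 * t ^ 5
      + 3 * t ^ 6 - t ^ 7 + 3 * t ^ 8 - 5 * t ^ 9 + 3 * t ^ 10 - t ^ 11 + t ^ 12) * ht

theorem PeriodInner.sq_add_sq {A B C D E G : ℂ} (h : PeriodInner A B C D E G) (v : Fin 6 → ℂ) :
    (A * DD0 v + C * (DD1 v + DD3 v + DD9 v) - D * (DD4 v + DD10 v + DD12 v)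
      + E * (DD2 v + DD5 v + DD6 v) - G * (DD7 v + DD8 v + DD11 v) + B * DDinf v) ^ 2
    + (B * DD0 v + D * (DD1 v + DD3 v + DD9 v) - (-C) * (DD4 v + DD10 v + DD12 v)
      + G * (DD2 v + DD5 v + DD6 v) - (-E) * (DD7 v + DD8 v + DD11 v) + (-A) * DDinf v) ^ 2
      = 13 * (-13 * GG0 v + (GG1 v + GG2 v + GG3 v + GG4 v + GG5 v + GG6 v + GG7 v + GG8 v
          + GG9 v + GG10 v + GG11 v + GG12 v)) := by
  simp only [GG0, GG1, GG2, GG3, GG4, GG5, GG6, GG7, GG8, GG9, GG10, GG11, GG12]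
  linear_combination (DD0 v ^ 2 + DDinf v ^ 2) * h.AB
    + (2 * DD0 v * DD1 v + 2 * DD0 v * DD3 v + 2 * DD0 v * DD9 v - 2 * DD4 v * DDinf v - 2
        * DD10 v * DDinf v - 2 * DD12 v * DDinf v) * h.AC
    + (2 * DD0 v * DD2 v + 2 * DD0 v * DD5 v + 2 * DD0 v * DD6 v - 2 * DD7 v * DDinf v - 2
        * DD8 v * DDinf v - 2 * DD11 v * DDinf v) * h.AE
    + (2 * DD0 v * DD4 v + 2 * DD0 v * DD10 v + 2 * DD0 v * DD12 v + 2 * DD1 v * DDinf v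
        + 2 * DD3 v * DDinf v + 2 * DD9 v * DDinf v) * h.BC
    + (2 * DD0 v * DD7 v + 2 * DD0 v * DD8 v + 2 * DD0 v * DD11 v + 2 * DD2 v * DDinf v
        + 2 * DD5 v * DDinf v + 2 * DD6 v * DDinf v) * h.BE
    + (DD1 v ^ 2 + 2 * DD1 v * DD3 v + 2 * DD1 v * DD9 v + DD3 v ^ 2 + 2 * DD3 v * DD9 v
        + DD4 v ^ 2 + 2 * DD4 v * DD10 v + 2 * DD4 v * DD12 v + DD9 v ^ 2 + DD10 v ^ 2
        + 2 * DD10 v * DD12 v + DD12 v ^ 2) * h.CD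
    + (2 * DD1 v * DD2 v + 2 * DD1 v * DD5 v + 2 * DD1 v * DD6 v + 2 * DD2 v * DD3 v
        + 2 * DD2 v * DD9 v + 2 * DD3 v * DD5 v + 2 * DD3 v * DD6 v + 2 * DD4 v * DD7 v
        + 2 * DD4 v * DD8 v + 2 * DD4 v * DD11 v + 2 * DD5 v * DD9 v + 2 * DD6 v * DD9 v
        + 2 * DD7 v * DD10 v + 2 * DD7 v * DD12 v + 2 * DD8 v * DD10 v + 2 * DD8 v * DD12 v
        + 2 * DD10 v * DD11 v + 2 * DD11 v * DD12 v) * h.CE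
    + (2 * DD1 v * DD7 v + 2 * DD1 v * DD8 v + 2 * DD1 v * DD11 v - 2 * DD2 v * DD4 v - 2 * DD2 v
        * DD10 v - 2 * DD2 v * DD12 v + 2 * DD3 v * DD7 v + 2 * DD3 v * DD8 v
        + 2 * DD3 v * DD11 v - 2 * DD4 v * DD5 v - 2 * DD4 v * DD6 v - 2 * DD5 v * DD10 v - 2
        * DD5 v * DD12 v - 2 * DD6 v * DD10 v - 2 * DD6 v * DD12 v + 2 * DD7 v * DD9 v
        + 2 * DD8 v * DD9 v + 2 * DD9 v * DD11 v) * h.DE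
    + (DD2 v ^ 2 + 2 * DD2 v * DD5 v + 2 * DD2 v * DD6 v + DD5 v ^ 2 + 2 * DD5 v * DD6 v
        + DD6 v ^ 2 + DD7 v ^ 2 + 2 * DD7 v * DD8 v + 2 * DD7 v * DD11 v + DD8 v ^ 2
        + 2 * DD8 v * DD11 v + DD11 v ^ 2) * h.EG

/-- The odd function on `ZMod 13` corresponding to a vector, read off on representatives. -/
def toV (y : ZMod 13 → ℂ) : Fin 6 → ℂ := ![y 2, y 6, y 5, y 3, y 9, y 1]

/-- The finite Fourier transform on `ZMod 13`, rescaled in frequency by `10`. -/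
def fourier13 (y : ZMod 13 → ℂ) (r : ZMod 13) : ℂ :=
  ∑ s, ZMod.stdAddChar (10 * r * s) * y s

/-- Multiplication by a quadratic character exponential on `ZMod 13`. -/
def chirp13 (a : ZMod 13) (y : ZMod 13 → ℂ) (r : ZMod 13) : ℂ :=
  ZMod.stdAddChar (5 * a * r ^ 2) * y r

theorem stdAddChar_thirteen (n : ℕ) : ZMod.stdAddChar (n : ZMod 13) = ζ ^ n := by
  have h := ZMod.stdAddChar_coe (N := 13) (n : ℤ)
  simp only [Int.cast_natCast] at h
  rw [h, ζ, ← Complex.exp_nat_mul]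
  congr 1
  push_cast
  ring

theorem stdAddChar_natCast_mul (n : ℕ) (b : ZMod 13) :
    ZMod.stdAddChar ((n : ZMod 13) * b) = (ZMod.stdAddChar b : ℂ) ^ n := by
  rw [← nsmul_eq_mul, AddChar.map_nsmul_eq_pow]

instance : Fact (Nat.Prime 13) := ⟨by norm_num⟩

theorem sum_stdAddChar_mul (b : ZMod 13) :
    ∑ s : ZMod 13, (ZMod.stdAddChar (b * s) : ℂ) = if b = 0 then 13 else 0 := by
  have := AddChar.sum_mulShift (R := ZMod 13) (R' := ℂ) b (ψ := ZMod.stdAddChar)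
    (ZMod.isPrimitive_stdAddChar 13)
  simp_rw [mul_comm b]
  rw [this]
  split_ifs <;> simp

theorem sum_ZMod_thirteen (f : ZMod 13 → ℂ) : ∑ s, f s = f 0 + f 1 + f 2 + f 3 + f 4 + f 5 + f 6
    + f 7 + f 8 + f 9 + f 10 + f 11 + f 12 := by
  have h (g : Fin 13 → ℂ) : ∑ s, g s = g 0 + g 1 + g 2 + g 3 + g 4 + g 5 + g 6
      + g 7 + g 8 + g 9 + g 10 + g 11 + g 12 := by
    rw [Fin.sum_univ_castSucc, Fin.sum_univ_castSucc, Fin.sum_univ_castSucc,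
      Fin.sum_univ_castSucc, Fin.sum_univ_castSucc, Fin.sum_univ_eight]
    rfl
  exact h f

theorem root_of_ne_zero {b : ZMod 13} (hb : b ≠ 0) {t : ℂ} (ht : ZMod.stdAddChar b = t) :
    1 + t + t ^ 2 + t ^ 3 + t ^ 4 + t ^ 5 + t ^ 6 + t ^ 7 + t ^ 8 + t ^ 9 + t ^ 10 + t ^ 11
      + t ^ 12 = 0 := by
  have h := sum_stdAddChar_mul b
  have key (n : ℕ) : (ZMod.stdAddChar (b * (n : ZMod 13)) : ℂ) = t ^ n := by
    rw [mul_comm, stdAddChar_natCast_mul, ht]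
  rw [if_neg hb, sum_ZMod_thirteen] at h
  have k0 := key 0; have k1 := key 1; have k2 := key 2; have k3 := key 3; have k4 := key 4
  have k5 := key 5; have k6 := key 6; have k7 := key 7; have k8 := key 8; have k9 := key 9
  have k10 := key 10; have k11 := key 11; have k12 := key 12
  push_cast at k0 k1 k2 k3 k4 k5 k6 k7 k8 k9 k10 k11 k12
  rw [k0, k1, k2, k3, k4, k5, k6, k7, k8, k9, k10, k11, k12] at h
  linear_combination h

theorem gauss_sum_sq {b : ZMod 13} (hb : b ≠ 0) :
    (∑ s : ZMod 13, (ZMod.stdAddChar (b * s ^ 2) : ℂ)) ^ 2 = 13 := by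
  have ht := root_of_ne_zero hb rfl
  rw [← gauss_period_sq ht, sum_ZMod_thirteen]
  have key (m : ZMod 13) (n : ℕ) (h : m ^ 2 = n) : (ZMod.stdAddChar (b * m ^ 2) : ℂ)
      = ZMod.stdAddChar b ^ n := by
    rw [h, mul_comm, stdAddChar_natCast_mul]
  rw [key 0 0 (by decide), key 1 1 (by decide), key 2 4 (by decide), key 3 9 (by decide),
    key 4 3 (by decide), key 5 12 (by decide), key 6 10 (by decide), key 7 10 (by decide),
    key 8 12 (by decide), key 9 3 (by decide), key 10 9 (by decide), key 11 4 (by decide),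
    key 12 1 (by decide)]
  ring

theorem Function.Odd.fourier13 {y : ZMod 13 → ℂ} (hy : y.Odd) : (fourier13 y).Odd := by
  intro r
  simp only [_root_.fourier13]
  rw [← Equiv.sum_comp (Equiv.neg (ZMod 13)), ← Finset.sum_neg_distrib]
  refine Finset.sum_congr rfl fun s _ ↦ ?_
  simp only [Equiv.neg_apply, hy s]
  ring_nf

theorem Function.Odd.chirp13 {y : ZMod 13 → ℂ} (hy : y.Odd) (a : ZMod 13) :
    (chirp13 a y).Odd := by
  intro r
  simp only [_root_.chirp13, hy r]
  ring_nf

theorem fourier13_fourier13 {y : ZMod 13 → ℂ} (hy : y.Odd) :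
    fourier13 (fourier13 y) = fun r ↦ -13 * y r := by
  ext r
  simp only [fourier13, Finset.mul_sum]
  rw [Finset.sum_comm]
  have (u s : ZMod 13) : (ZMod.stdAddChar (10 * r * s) : ℂ) * (ZMod.stdAddChar (10 * s * u) * y u)
      = ZMod.stdAddChar (10 * (r + u) * s) * y u := by
    rw [← mul_assoc, ← AddChar.map_add_eq_mul]
    ring_nf
  simp_rw [this, ← Finset.sum_mul, sum_stdAddChar_mul]
  have h10 (u : ZMod 13) : 10 * (r + u) = 0 ↔ u = -r := by
    have : (10 : ZMod 13) ≠ 0 := by decide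
    rw [mul_eq_zero, or_iff_right this, add_eq_zero_iff_neg_eq, eq_comm]
  simp_rw [h10, ite_mul, zero_mul]
  rw [Finset.sum_ite_eq' Finset.univ (-r)]
  simp [hy r]

/-- Completing the square. -/
theorem fourier13_chirp13_fourier13 (y : ZMod 13 → ℂ) {a : ZMod 13} (ha : a ≠ 0) :
    fourier13 (chirp13 a (fourier13 y)) = fun r ↦ (∑ s : ZMod 13,
        (ZMod.stdAddChar (5 * a * s ^ 2) : ℂ))
      * chirp13 (-a⁻¹) (fun r ↦ fourier13 (chirp13 (-a⁻¹) y) (-a⁻¹ * r)) r := by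
  ext r
  simp only [fourier13, chirp13, Finset.mul_sum, Finset.sum_mul]
  rw [Finset.sum_comm]
  refine Finset.sum_congr rfl fun u _ ↦ ?_
  rw [← Equiv.sum_comp (Equiv.addRight (a⁻¹ * (r + u)))
    (fun s ↦ (ZMod.stdAddChar (5 * a * s ^ 2) : ℂ) * _)]
  refine Finset.sum_congr rfl fun s _ ↦ ?_
  simp only [Equiv.coe_addRight]
  simp only [← mul_assoc, ← AddChar.map_add_eq_mul]
  congr 2
  field_simp
  ring

section Invariance

variable {hI h0 : (ZMod 13 → ℂ) → ℂ} {m : ℕ}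

/-- The abstract properties of the forms `wInf, wF 0` and `dInf, dF 0` which
imply the invariance of power sums. -/
structure ProjLinePair (hI h0 : (ZMod 13 → ℂ) → ℂ) (m : ℕ) : Prop where
  fourier : ∀ y : ZMod 13 → ℂ, y.Odd → hI (fourier13 y) = 13 ^ m * h0 y
  smul : ∀ (c : ℂ) (y : ZMod 13 → ℂ), hI (fun r ↦ c * y r) = c ^ (2 * m) * hI y
  chirp : ∀ (a : ZMod 13) (y : ZMod 13 → ℂ), y.Odd → hI (chirp13 a y) = hI y
  dilation : ∀ (k : ZMod 13) (y : ZMod 13 → ℂ), k ≠ 0 → y.Odd → hI (fun r ↦ y (k * r)) = hI y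

/-- The power sums over the projective line over `ZMod 13`. -/
def lineSum (hI h0 : (ZMod 13 → ℂ) → ℂ) (k : ℕ) (y : ZMod 13 → ℂ) : ℂ :=
  (∑ a, h0 (chirp13 a y) ^ k) + hI y ^ k

theorem ProjLinePair.lineSum_chirp (h : ProjLinePair hI h0 m) (k : ℕ) (b : ZMod 13)
    {y : ZMod 13 → ℂ} (hy : y.Odd) : lineSum hI h0 k (chirp13 b y) = lineSum hI h0 k y := by
  simp only [lineSum, h.chirp b y hy]
  congr 1
  rw [← Equiv.sum_comp (Equiv.addRight b) (fun a ↦ h0 (chirp13 a y) ^ k)]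
  refine Finset.sum_congr rfl fun a _ ↦ ?_
  congr 2
  ext r
  simp only [chirp13, Equiv.coe_addRight]
  rw [← mul_assoc, ← AddChar.map_add_eq_mul]
  ring_nf

theorem ProjLinePair.lineSum_fourier (h : ProjLinePair hI h0 m) (k : ℕ)
    {y : ZMod 13 → ℂ} (hy : y.Odd) :
    lineSum hI h0 k (fourier13 y) = (13 ^ m) ^ k * lineSum hI h0 k y := by
  have hK : (13 ^ m : ℂ) ≠ 0 := pow_ne_zero _ (by norm_num)
  have hzero : h0 (fourier13 y) = 13 ^ m * hI y := by
    apply mul_left_cancel₀ hK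
    rw [← h.fourier _ hy.fourier13, fourier13_fourier13 hy, h.smul, pow_mul, neg_sq,
      ← pow_mul, two_mul, pow_add, mul_assoc]
  have hne (a : ZMod 13) (ha : a ≠ 0) :
      h0 (chirp13 a (fourier13 y)) = 13 ^ m * h0 (chirp13 (-a⁻¹) y) := by
    apply mul_left_cancel₀ hK
    rw [← h.fourier _ (hy.fourier13.chirp13 a), ← h.fourier _ (hy.chirp13 _),
      fourier13_chirp13_fourier13 y ha, h.smul, pow_mul, gauss_sum_sq
        (mul_ne_zero (by decide) ha), h.chirp, h.dilation _ _ (by simpa using ha)]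
    · exact (hy.chirp13 _).fourier13
    · intro r
      have := (hy.chirp13 (-a⁻¹)).fourier13 (-a⁻¹ * r)
      rw [← this]
      ring_nf
  have hpt (a : ZMod 13) : h0 (chirp13 a (fourier13 y)) ^ k = (13 ^ m) ^ k *
      ((if a = 0 then hI y ^ k - h0 y ^ k else 0) + h0 (chirp13 (-a⁻¹) y) ^ k) := by
    have h00 (y : ZMod 13 → ℂ) : chirp13 0 y = y := by ext; simp [chirp13]
    split_ifs with ha
    · simp [ha, h00, hzero, mul_pow]
    · simp [hne a ha, mul_pow]
  have hinv : Function.Involutive (fun a : ZMod 13 ↦ -a⁻¹) := fun a ↦ by simp [inv_neg]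
  simp only [lineSum, hpt, ← Finset.mul_sum, Finset.sum_add_distrib, Finset.sum_ite_eq',
    Finset.mem_univ, if_true, h.fourier y hy]
  rw [← Equiv.sum_comp (hinv.toPerm) (fun a ↦ h0 (chirp13 a y) ^ k)]
  simp only [Function.Involutive.coe_toPerm, mul_pow]
  ring

end Invariance

theorem Function.Odd.values {y : ZMod 13 → ℂ} (hy : y.Odd) :
    y 12 = -y 1 ∧ y 11 = -y 2 ∧ y 10 = -y 3 ∧ y 4 = -y 9 ∧ y 8 = -y 5 ∧ y 7 = -y 6 :=
  ⟨hy 1, hy 2, hy 3, hy 9, hy 5, hy 6⟩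

theorem dilation_induction {P : (ZMod 13 → ℂ) → Prop} (y : ZMod 13 → ℂ)
    (hP : ∀ u, P u → P (fun r ↦ u (2 * r))) (h : P y) {k : ZMod 13} (hk : k ≠ 0) :
    P (fun r ↦ y (k * r)) := by
  have key (n : ℕ) : P (fun r ↦ y (2 ^ n * r)) := by
    induction n with
    | zero => simpa using h
    | succ n ih => simpa [pow_succ, mul_assoc] using hP _ ih
  obtain ⟨n, -, rfl⟩ : ∃ n < 12, k = 2 ^ n := by revert k; decide
  exact key n

theorem toV_dilation {y : ZMod 13 → ℂ} (hy : y.Odd) :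
    toV (fun r ↦ y (2 * r)) = ![-y 9, -y 1, -y 3, y 6, y 5, y 2] := by
  obtain ⟨h12, h11, h10, h4, h8, h7⟩ := hy.values
  rw [← h4, ← h12, ← h10]
  rfl

/-- The diagonal action on vectors induced by `chirp13`. -/
def chirpV (t : ℂ) (v : Fin 6 → ℂ) : Fin 6 → ℂ :=
  ![t ^ 7 * v 0, t ^ 11 * v 1, t ^ 8 * v 2, t ^ 6 * v 3, t ^ 2 * v 4, t ^ 5 * v 5]

theorem toV_chirp13 (a : ZMod 13) (y : ZMod 13 → ℂ) : toV (chirp13 a y) =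
    chirpV (ZMod.stdAddChar a) (toV y) := by
  have key (m : ZMod 13) (n : ℕ) (h : 5 * m ^ 2 = n) :
      chirp13 a y m = ZMod.stdAddChar a ^ n * y m := by
    rw [chirp13, mul_right_comm, h, stdAddChar_natCast_mul]
  simp only [toV]
  rw [key 2 7 (by decide), key 6 11 (by decide), key 5 8 (by decide), key 3 6 (by decide),
    key 9 2 (by decide), key 1 5 (by decide)]
  rfl

/-- The action on vectors induced by `fourier13`. -/
def fourierV (a1 a2 a3 c1 c2 c3 : ℂ) (v : Fin 6 → ℂ) : Fin 6 → ℂ := ![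
  a1 * v 0 + a2 * v 1 + a3 * v 2 + c1 * v 3 + c2 * v 4 + c3 * v 5,
  a2 * v 0 + a3 * v 1 + a1 * v 2 + c2 * v 3 + c3 * v 4 + c1 * v 5,
  a3 * v 0 + a1 * v 1 + a2 * v 2 + c3 * v 3 + c1 * v 4 + c2 * v 5,
  c1 * v 0 + c2 * v 1 + c3 * v 2 + -a1 * v 3 + -a2 * v 4 + -a3 * v 5,
  c2 * v 0 + c3 * v 1 + c1 * v 2 + -a2 * v 3 + -a3 * v 4 + -a1 * v 5,
  c3 * v 0 + c1 * v 1 + c2 * v 2 + -a3 * v 3 + -a1 * v 4 + -a2 * v 5]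

theorem toV_fourier13 {y : ZMod 13 → ℂ} (hy : y.Odd) :
    toV (fourier13 y) = fourierV (ζ - ζ ^ 12) (ζ ^ 3 - ζ ^ 10) (ζ ^ 9 - ζ ^ 4)
      (ζ ^ 8 - ζ ^ 5) (ζ ^ 11 - ζ ^ 2) (ζ ^ 7 - ζ ^ 6) (toV y) := by
  obtain ⟨g12, g11, g10, g4, g8, g7⟩ := hy.values
  have g0 : y 0 = 0 := by
    have := hy 0
    rw [neg_zero] at this
    linear_combination this / 2
  have row (r : ZMod 13) (k : ℕ) (hk : 10 * r = k) :
      fourier13 y r = ∑ n ∈ Finset.range 13, ζ ^ ((k * n) % 13) * y n := by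
    rw [fourier13, sum_ZMod_thirteen]
    simp only [Finset.sum_range_succ, Finset.sum_range_zero, zero_add, hk]
    have (x : ZMod 13) (j : ℕ) (h : j = x) : (ZMod.stdAddChar ((k : ZMod 13) * x) : ℂ) =
        ζ ^ (k * j % 13) := by
      rw [← stdAddChar_thirteen, ← h, ← Nat.cast_mul, ZMod.natCast_mod]
    rw [this 0 0 (by rfl), this 1 1 (by rfl), this 2 2 (by rfl), this 3 3 (by rfl),
      this 4 4 (by rfl), this 5 5 (by rfl), this 6 6 (by rfl), this 7 7 (by rfl),
      this 8 8 (by rfl), this 9 9 (by rfl), this 10 10 (by rfl), this 11 11 (by rfl),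
      this 12 12 (by rfl)]
    rfl
  have h2 := row 2 20 (by rfl)
  have h6 := row 6 60 (by rfl)
  have h5 := row 5 50 (by rfl)
  have h3 := row 3 30 (by rfl)
  have h9 := row 9 90 (by rfl)
  have h1 := row 1 10 (by rfl)
  simp only [Finset.sum_range_succ, Finset.sum_range_zero, Nat.cast_ofNat, Nat.cast_one,
    Nat.cast_zero, g0, g12, g11, g10, g4, g8, g7, Nat.reduceMul, Nat.reduceMod] at h2 h6 h5 h3 h9 h1
  simp only [toV, fourierV, h2, h6, h5, h3, h9, h1, Matrix.cons_val]
  congr! 1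
  · ring
  congr! 1
  · ring
  congr! 1
  · ring
  congr! 1
  · ring
  congr! 1
  · ring
  congr! 1
  ring

theorem zeta_root : 1 + ζ + ζ ^ 2 + ζ ^ 3 + ζ ^ 4 + ζ ^ 5 + ζ ^ 6 + ζ ^ 7 + ζ ^ 8 + ζ ^ 9 + ζ ^ 10
    + ζ ^ 11 + ζ ^ 12 = 0 :=
  root_of_ne_zero (b := 1) (by decide) (by simpa using stdAddChar_thirteen 1)

section Chirp

variable {t : ℂ}

theorem pow_eq_of_pow_thirteen (ht : t ^ 13 = 1) {n m : ℕ} (h : n % 13 = m % 13) :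
    t ^ n = t ^ m := by
  rw [← Nat.div_add_mod n 13, ← Nat.div_add_mod m 13, h]
  simp [pow_add, pow_mul, ht]

theorem AA0_chirpV (ht : t ^ 13 = 1) (v : Fin 6 → ℂ) :
    AA0 (chirpV t v) = AA0 v := by
  have h13 : t ^ 13 = t ^ 0 := pow_eq_of_pow_thirteen ht rfl
  simp only [AA0, chirpV, Matrix.cons_val]
  ring_nf
  simp only [h13]
  ring_nf

theorem AA1_chirpV (ht : t ^ 13 = 1) (v : Fin 6 → ℂ) :
    AA1 (chirpV t v) = t * AA1 v := by
  have h14 : t ^ 14 = t ^ 1 := pow_eq_of_pow_thirteen ht rfl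
  simp only [AA1, chirpV, Matrix.cons_val]
  ring_nf
  simp only [h14]
  ring_nf

theorem AA2_chirpV (ht : t ^ 13 = 1) (v : Fin 6 → ℂ) :
    AA2 (chirpV t v) = t ^ 4 * AA2 v := by
  have h17 : t ^ 17 = t ^ 4 := pow_eq_of_pow_thirteen ht rfl
  simp only [AA2, chirpV, Matrix.cons_val]
  ring_nf
  simp only [h17]

theorem AA3_chirpV (ht : t ^ 13 = 1) (v : Fin 6 → ℂ) :
    AA3 (chirpV t v) = t ^ 9 * AA3 v := by
  have h22 : t ^ 22 = t ^ 9 := pow_eq_of_pow_thirteen ht rfl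
  simp only [AA3, chirpV, Matrix.cons_val]
  ring_nf
  simp only [h22]
  ring_nf

theorem AA4_chirpV (ht : t ^ 13 = 1) (v : Fin 6 → ℂ) :
    AA4 (chirpV t v) = t ^ 3 * AA4 v := by
  have h16 : t ^ 16 = t ^ 3 := pow_eq_of_pow_thirteen ht rfl
  simp only [AA4, chirpV, Matrix.cons_val]
  ring_nf
  simp only [h16]

theorem AA5_chirpV (v : Fin 6 → ℂ) :
    AA5 (chirpV t v) = t ^ 12 * AA5 v := by
  simp only [AA5, chirpV, Matrix.cons_val]
  ring_nf

theorem AA6_chirpV (v : Fin 6 → ℂ) :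
    AA6 (chirpV t v) = t ^ 10 * AA6 v := by
  simp only [AA6, chirpV, Matrix.cons_val]
  ring_nf

theorem DD0_chirpV (ht : t ^ 13 = 1) (v : Fin 6 → ℂ) :
    DD0 (chirpV t v) = DD0 v := by
  have h26 : t ^ 26 = t ^ 0 := pow_eq_of_pow_thirteen ht rfl
  simp only [DD0, chirpV, Matrix.cons_val]
  ring_nf
  simp only [h26]
  ring_nf

theorem DD1_chirpV (ht : t ^ 13 = 1) (v : Fin 6 → ℂ) :
    DD1 (chirpV t v) = t * DD1 v := by
  have h14 : t ^ 14 = t ^ 1 := pow_eq_of_pow_thirteen ht rfl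
  have h27 : t ^ 27 = t ^ 1 := pow_eq_of_pow_thirteen ht rfl
  simp only [DD1, chirpV, Matrix.cons_val]
  ring_nf
  simp only [h14, h27]
  ring_nf

theorem DD2_chirpV (ht : t ^ 13 = 1) (v : Fin 6 → ℂ) :
    DD2 (chirpV t v) = t ^ 2 * DD2 v := by
  have h15 : t ^ 15 = t ^ 2 := pow_eq_of_pow_thirteen ht rfl
  have h28 : t ^ 28 = t ^ 2 := pow_eq_of_pow_thirteen ht rfl
  simp only [DD2, chirpV, Matrix.cons_val]
  ring_nf
  simp only [h15, h28]
  ring_nf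

theorem DD3_chirpV (ht : t ^ 13 = 1) (v : Fin 6 → ℂ) :
    DD3 (chirpV t v) = t ^ 3 * DD3 v := by
  have h16 : t ^ 16 = t ^ 3 := pow_eq_of_pow_thirteen ht rfl
  have h29 : t ^ 29 = t ^ 3 := pow_eq_of_pow_thirteen ht rfl
  simp only [DD3, chirpV, Matrix.cons_val]
  ring_nf
  simp only [h16, h29]
  ring_nf

theorem DD4_chirpV (ht : t ^ 13 = 1) (v : Fin 6 → ℂ) :
    DD4 (chirpV t v) = t ^ 4 * DD4 v := by
  have h17 : t ^ 17 = t ^ 4 := pow_eq_of_pow_thirteen ht rfl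
  have h30 : t ^ 30 = t ^ 4 := pow_eq_of_pow_thirteen ht rfl
  simp only [DD4, chirpV, Matrix.cons_val]
  ring_nf
  simp only [h17, h30]
  ring_nf

theorem DD5_chirpV (ht : t ^ 13 = 1) (v : Fin 6 → ℂ) :
    DD5 (chirpV t v) = t ^ 5 * DD5 v := by
  have h18 : t ^ 18 = t ^ 5 := pow_eq_of_pow_thirteen ht rfl
  simp only [DD5, chirpV, Matrix.cons_val]
  ring_nf
  simp only [h18]

theorem DD6_chirpV (ht : t ^ 13 = 1) (v : Fin 6 → ℂ) :
    DD6 (chirpV t v) = t ^ 6 * DD6 v := by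
  have h19 : t ^ 19 = t ^ 6 := pow_eq_of_pow_thirteen ht rfl
  simp only [DD6, chirpV, Matrix.cons_val]
  ring_nf
  simp only [h19]
  ring_nf

theorem DD7_chirpV (ht : t ^ 13 = 1) (v : Fin 6 → ℂ) :
    DD7 (chirpV t v) = t ^ 7 * DD7 v := by
  have h20 : t ^ 20 = t ^ 7 := pow_eq_of_pow_thirteen ht rfl
  have h33 : t ^ 33 = t ^ 7 := pow_eq_of_pow_thirteen ht rfl
  simp only [DD7, chirpV, Matrix.cons_val]
  ring_nf
  simp only [h20, h33]
  ring_nf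

theorem DD8_chirpV (ht : t ^ 13 = 1) (v : Fin 6 → ℂ) :
    DD8 (chirpV t v) = t ^ 8 * DD8 v := by
  have h21 : t ^ 21 = t ^ 8 := pow_eq_of_pow_thirteen ht rfl
  simp only [DD8, chirpV, Matrix.cons_val]
  ring_nf
  simp only [h21]

theorem DD9_chirpV (ht : t ^ 13 = 1) (v : Fin 6 → ℂ) :
    DD9 (chirpV t v) = t ^ 9 * DD9 v := by
  have h22 : t ^ 22 = t ^ 9 := pow_eq_of_pow_thirteen ht rfl
  simp only [DD9, chirpV, Matrix.cons_val]
  ring_nf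
  simp only [h22]
  ring_nf

theorem DD10_chirpV (ht : t ^ 13 = 1) (v : Fin 6 → ℂ) :
    DD10 (chirpV t v) = t ^ 10 * DD10 v := by
  have h23 : t ^ 23 = t ^ 10 := pow_eq_of_pow_thirteen ht rfl
  simp only [DD10, chirpV, Matrix.cons_val]
  ring_nf
  simp only [h23]
  ring_nf

theorem DD11_chirpV (ht : t ^ 13 = 1) (v : Fin 6 → ℂ) :
    DD11 (chirpV t v) = t ^ 11 * DD11 v := by
  have h24 : t ^ 24 = t ^ 11 := pow_eq_of_pow_thirteen ht rfl
  simp only [DD11, chirpV, Matrix.cons_val]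
  ring_nf
  simp only [h24]
  ring_nf

theorem DD12_chirpV (ht : t ^ 13 = 1) (v : Fin 6 → ℂ) :
    DD12 (chirpV t v) = t ^ 12 * DD12 v := by
  have h25 : t ^ 25 = t ^ 12 := pow_eq_of_pow_thirteen ht rfl
  simp only [DD12, chirpV, Matrix.cons_val]
  ring_nf
  simp only [h25]
  ring_nf

theorem DDinf_chirpV (ht : t ^ 13 = 1) (v : Fin 6 → ℂ) :
    DDinf (chirpV t v) = DDinf v := by
  have h13 : t ^ 13 = t ^ 0 := pow_eq_of_pow_thirteen ht rfl
  simp only [DDinf, chirpV, Matrix.cons_val]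
  ring_nf
  simp only [h13]
  ring_nf

theorem GG0_chirpV (ht : t ^ 13 = 1) (v : Fin 6 → ℂ) :
    GG0 (chirpV t v) = GG0 v := by
  simp only [GG0, DD0_chirpV ht, DDinf_chirpV ht]

theorem GG1_chirpV (ht : t ^ 13 = 1) (v : Fin 6 → ℂ) :
    GG1 (chirpV t v) = t * GG1 v := by
  have h14 : t ^ 14 = t ^ 1 := pow_eq_of_pow_thirteen ht rfl
  simp only [GG1, DD0_chirpV ht, DD1_chirpV ht, DD10_chirpV ht, DD11_chirpV ht, DD12_chirpV ht,
      DD2_chirpV ht, DD3_chirpV ht, DD4_chirpV ht, DD5_chirpV ht, DD7_chirpV ht, DD9_chirpV ht,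
      DDinf_chirpV ht]
  ring_nf
  simp only [h14]
  ring_nf

theorem GG2_chirpV (ht : t ^ 13 = 1) (v : Fin 6 → ℂ) :
    GG2 (chirpV t v) = t ^ 2 * GG2 v := by
  have h15 : t ^ 15 = t ^ 2 := pow_eq_of_pow_thirteen ht rfl
  simp only [GG2, DD0_chirpV ht, DD1_chirpV ht, DD10_chirpV ht, DD11_chirpV ht, DD2_chirpV ht,
      DD4_chirpV ht, DD5_chirpV ht, DD6_chirpV ht, DD7_chirpV ht, DD8_chirpV ht, DD9_chirpV ht,
      DDinf_chirpV ht]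
  ring_nf
  simp only [h15]

theorem GG3_chirpV (ht : t ^ 13 = 1) (v : Fin 6 → ℂ) :
    GG3 (chirpV t v) = t ^ 3 * GG3 v := by
  have h16 : t ^ 16 = t ^ 3 := pow_eq_of_pow_thirteen ht rfl
  simp only [GG3, DD0_chirpV ht, DD1_chirpV ht, DD10_chirpV ht, DD12_chirpV ht, DD2_chirpV ht,
      DD3_chirpV ht, DD4_chirpV ht, DD6_chirpV ht, DD7_chirpV ht, DD8_chirpV ht, DD9_chirpV ht,
      DDinf_chirpV ht]
  ring_nf
  simp only [h16]
  ring_nf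

theorem GG4_chirpV (ht : t ^ 13 = 1) (v : Fin 6 → ℂ) :
    GG4 (chirpV t v) = t ^ 4 * GG4 v := by
  have h17 : t ^ 17 = t ^ 4 := pow_eq_of_pow_thirteen ht rfl
  simp only [GG4, DD0_chirpV ht, DD1_chirpV ht, DD10_chirpV ht, DD12_chirpV ht, DD2_chirpV ht,
      DD3_chirpV ht, DD4_chirpV ht, DD5_chirpV ht, DD7_chirpV ht, DD8_chirpV ht, DD9_chirpV ht,
      DDinf_chirpV ht]
  ring_nf
  simp only [h17]
  ring_nf

theorem GG5_chirpV (ht : t ^ 13 = 1) (v : Fin 6 → ℂ) :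
    GG5 (chirpV t v) = t ^ 5 * GG5 v := by
  have h18 : t ^ 18 = t ^ 5 := pow_eq_of_pow_thirteen ht rfl
  simp only [GG5, DD0_chirpV ht, DD10_chirpV ht, DD11_chirpV ht, DD12_chirpV ht, DD2_chirpV ht,
      DD3_chirpV ht, DD5_chirpV ht, DD6_chirpV ht, DD7_chirpV ht, DD8_chirpV ht, DD9_chirpV ht,
      DDinf_chirpV ht]
  ring_nf
  simp only [h18]
  ring_nf

theorem GG6_chirpV (ht : t ^ 13 = 1) (v : Fin 6 → ℂ) :
    GG6 (chirpV t v) = t ^ 6 * GG6 v := by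
  have h19 : t ^ 19 = t ^ 6 := pow_eq_of_pow_thirteen ht rfl
  simp only [GG6, DD0_chirpV ht, DD1_chirpV ht, DD11_chirpV ht, DD12_chirpV ht, DD2_chirpV ht,
      DD3_chirpV ht, DD4_chirpV ht, DD5_chirpV ht, DD6_chirpV ht, DD7_chirpV ht, DD8_chirpV ht,
      DDinf_chirpV ht]
  ring_nf
  simp only [h19]
  ring_nf

theorem GG7_chirpV (ht : t ^ 13 = 1) (v : Fin 6 → ℂ) :
    GG7 (chirpV t v) = t ^ 7 * GG7 v := by
  have h20 : t ^ 20 = t ^ 7 := pow_eq_of_pow_thirteen ht rfl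
  simp only [GG7, DD0_chirpV ht, DD1_chirpV ht, DD10_chirpV ht, DD11_chirpV ht, DD12_chirpV ht,
      DD2_chirpV ht, DD5_chirpV ht, DD6_chirpV ht, DD7_chirpV ht, DD8_chirpV ht, DD9_chirpV ht,
      DDinf_chirpV ht]
  ring_nf
  simp only [h20]
  ring_nf

theorem GG8_chirpV (ht : t ^ 13 = 1) (v : Fin 6 → ℂ) :
    GG8 (chirpV t v) = t ^ 8 * GG8 v := by
  have h21 : t ^ 21 = t ^ 8 := pow_eq_of_pow_thirteen ht rfl
  simp only [GG8, DD0_chirpV ht, DD1_chirpV ht, DD10_chirpV ht, DD11_chirpV ht, DD2_chirpV ht,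
      DD3_chirpV ht, DD4_chirpV ht, DD5_chirpV ht, DD6_chirpV ht, DD7_chirpV ht, DD8_chirpV ht,
      DDinf_chirpV ht]
  ring_nf
  simp only [h21]
  ring_nf

theorem GG9_chirpV (ht : t ^ 13 = 1) (v : Fin 6 → ℂ) :
    GG9 (chirpV t v) = t ^ 9 * GG9 v := by
  have h22 : t ^ 22 = t ^ 9 := pow_eq_of_pow_thirteen ht rfl
  simp only [GG9, DD0_chirpV ht, DD1_chirpV ht, DD10_chirpV ht, DD11_chirpV ht, DD12_chirpV ht,
      DD3_chirpV ht, DD4_chirpV ht, DD5_chirpV ht, DD6_chirpV ht, DD8_chirpV ht, DD9_chirpV ht,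
      DDinf_chirpV ht]
  ring_nf
  simp only [h22]
  ring_nf

theorem GG10_chirpV (ht : t ^ 13 = 1) (v : Fin 6 → ℂ) :
    GG10 (chirpV t v) = t ^ 10 * GG10 v := by
  have h23 : t ^ 23 = t ^ 10 := pow_eq_of_pow_thirteen ht rfl
  simp only [GG10, DD0_chirpV ht, DD1_chirpV ht, DD10_chirpV ht, DD11_chirpV ht, DD12_chirpV ht,
      DD3_chirpV ht, DD4_chirpV ht, DD5_chirpV ht, DD6_chirpV ht, DD7_chirpV ht, DD9_chirpV ht,
      DDinf_chirpV ht]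
  ring_nf
  simp only [h23]

theorem GG11_chirpV (ht : t ^ 13 = 1) (v : Fin 6 → ℂ) :
    GG11 (chirpV t v) = t ^ 11 * GG11 v := by
  have h24 : t ^ 24 = t ^ 11 := pow_eq_of_pow_thirteen ht rfl
  simp only [GG11, DD0_chirpV ht, DD11_chirpV ht, DD12_chirpV ht, DD2_chirpV ht, DD3_chirpV ht,
      DD4_chirpV ht, DD5_chirpV ht, DD6_chirpV ht, DD7_chirpV ht, DD8_chirpV ht, DD9_chirpV ht,
      DDinf_chirpV ht]
  ring_nf
  simp only [h24]
  ring_nf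

theorem GG12_chirpV (ht : t ^ 13 = 1) (v : Fin 6 → ℂ) :
    GG12 (chirpV t v) = t ^ 12 * GG12 v := by
  simp only [GG12, DD0_chirpV ht, DD1_chirpV ht, DD10_chirpV ht, DD11_chirpV ht, DD12_chirpV ht,
      DD2_chirpV ht, DD3_chirpV ht, DD4_chirpV ht, DD6_chirpV ht, DD8_chirpV ht, DD9_chirpV ht,
      DDinf_chirpV ht]
  ring_nf

end Chirp

theorem stdAddChar_pow_thirteen (a : ZMod 13) : (ZMod.stdAddChar a : ℂ) ^ 13 = 1 := by
  rw [← stdAddChar_natCast_mul, show ((13 : ℕ) : ZMod 13) = 0 from rfl, zero_mul,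
    AddChar.map_zero_eq_one]

theorem zeta_pow_thirteen : ζ ^ 13 = 1 := by
  rw [← stdAddChar_thirteen]
  exact AddChar.map_zero_eq_one _

theorem wF_toV (n : ℕ) (y : ZMod 13 → ℂ) : wF n (toV y) = wF 0 (toV (chirp13 n y)) := by
  have ht : (ζ ^ n) ^ 13 = 1 := by rw [← pow_mul, mul_comm, pow_mul, zeta_pow_thirteen, one_pow]
  rw [toV_chirp13, stdAddChar_thirteen]
  simp only [wF, AA0_chirpV ht, AA1_chirpV ht, AA2_chirpV ht, AA3_chirpV ht, AA4_chirpV ht,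
    AA5_chirpV, AA6_chirpV]
  ring

theorem dF_toV (n : ℕ) (y : ZMod 13 → ℂ) : dF n (toV y) = dF 0 (toV (chirp13 n y)) := by
  have ht : (ζ ^ n) ^ 13 = 1 := by rw [← pow_mul, mul_comm, pow_mul, zeta_pow_thirteen, one_pow]
  rw [toV_chirp13, stdAddChar_thirteen]
  simp only [dF, GG0_chirpV ht, GG1_chirpV ht, GG2_chirpV ht, GG3_chirpV ht, GG4_chirpV ht,
    GG5_chirpV ht, GG6_chirpV ht, GG7_chirpV ht, GG8_chirpV ht, GG9_chirpV ht, GG10_chirpV ht,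
    GG11_chirpV ht, GG12_chirpV ht]
  ring

theorem toV_smul (c : ℂ) (y : ZMod 13 → ℂ) : toV (fun r ↦ c * y r) = fun i ↦ c * toV y i := by
  ext i
  fin_cases i <;> rfl

theorem projLinePair_w : ProjLinePair (fun y ↦ wInf (toV y)) (fun y ↦ wF 0 (toV y)) 2 where
  fourier y hy := by
    have h := (quadPeriodRel_of_root zeta_root).AA0_eq (toV y)
    have hs := gauss_period_sq zeta_root
    simp only [toV_fourier13 hy, wInf, wF]
    have : AA0 (fourierV (ζ - ζ ^ 12) (ζ ^ 3 - ζ ^ 10) (ζ ^ 9 - ζ ^ 4)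
      (ζ ^ 8 - ζ ^ 5) (ζ ^ 11 - ζ ^ 2) (ζ ^ 7 - ζ ^ 6) (toV y)) = _ := h
    rw [this, mul_pow, hs]
    ring
  smul c y := by
    simp only [toV_smul, wInf, AA0]
    ring
  chirp a y _ := by
    simp only [toV_chirp13, wInf, AA0_chirpV (stdAddChar_pow_thirteen a)]
  dilation k y hk hy := by
    refine (dilation_induction (P := fun u ↦ u.Odd ∧ wInf (toV u) = wInf (toV y)) y ?_
      ⟨hy, rfl⟩ hk).2
    rintro u ⟨hu, h⟩
    refine ⟨fun r ↦ by simp only [mul_neg, hu (2 * r)], ?_⟩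
    rw [← h, toV_dilation hu]
    simp only [wInf, AA0, toV, Matrix.cons_val]
    ring

theorem projLinePair_d : ProjLinePair (fun y ↦ dInf (toV y)) (fun y ↦ dF 0 (toV y)) 3 where
  fourier y hy := by
    have hP := periodRel_of_root zeta_root
    have h := hP.DD0_eq (toV y)
    have h' := hP.swap.DD0_eq (toV y)
    have hI := (periodInner_of_root zeta_root).sq_add_sq (toV y)
    simp only [toV_fourier13 hy, dInf, dF, GG0]
    have e : DD0 (fourierV (ζ - ζ ^ 12) (ζ ^ 3 - ζ ^ 10) (ζ ^ 9 - ζ ^ 4)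
      (ζ ^ 8 - ζ ^ 5) (ζ ^ 11 - ζ ^ 2) (ζ ^ 7 - ζ ^ 6) (toV y)) = _ := h
    have e' : DDinf (fourierV (ζ - ζ ^ 12) (ζ ^ 3 - ζ ^ 10) (ζ ^ 9 - ζ ^ 4)
      (ζ ^ 8 - ζ ^ 5) (ζ ^ 11 - ζ ^ 2) (ζ ^ 7 - ζ ^ 6) (toV y)) = _ := h'
    rw [e, e', hI, GG0]
    ring
  smul c y := by
    simp only [toV_smul, dInf, GG0, DD0, DDinf]
    ring
  chirp a y _ := by
    simp only [toV_chirp13, dInf, GG0_chirpV (stdAddChar_pow_thirteen a)]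
  dilation k y hk hy := by
    refine (dilation_induction (P := fun u ↦ u.Odd ∧ dInf (toV u) = dInf (toV y)) y ?_
      ⟨hy, rfl⟩ hk).2
    rintro u ⟨hu, h⟩
    refine ⟨fun r ↦ by simp only [mul_neg, hu (2 * r)], ?_⟩
    rw [← h, toV_dilation hu]
    simp only [dInf, GG0, DD0, DDinf, toV, Matrix.cons_val]
    ring

theorem sum_range_thirteen (f : ZMod 13 → ℂ) :
    ∑ n ∈ Finset.range 13, f n = ∑ a, f a := by
  rw [sum_ZMod_thirteen]
  simp [Finset.sum_range_succ]

/-- The power sum of degree `6 * k` attached to the forms `dInf, dF`. -/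
def dSum (k : ℕ) (v : Fin 6 → ℂ) : ℂ := (∑ ν ∈ Finset.range 13, (dF ν v) ^ k) + (dInf v) ^ k

/-- The power sum of degree `4 * k` attached to the forms `wInf, wF`. -/
def wSum (k : ℕ) (v : Fin 6 → ℂ) : ℂ := (∑ ν ∈ Finset.range 13, (wF ν v) ^ k) + (wInf v) ^ k

theorem dSum_toV (k : ℕ) (y : ZMod 13 → ℂ) :
    dSum k (toV y) = lineSum (fun y ↦ dInf (toV y)) (fun y ↦ dF 0 (toV y)) k y := by
  simp only [dSum, lineSum, dF_toV _ y]
  rw [sum_range_thirteen (fun a ↦ dF 0 (toV (chirp13 a y)) ^ k)]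

theorem wSum_toV (k : ℕ) (y : ZMod 13 → ℂ) :
    wSum k (toV y) = lineSum (fun y ↦ wInf (toV y)) (fun y ↦ wF 0 (toV y)) k y := by
  simp only [wSum, lineSum, wF_toV _ y]
  rw [sum_range_thirteen (fun a ↦ wF 0 (toV (chirp13 a y)) ^ k)]

theorem dSum_chirp (k : ℕ) (b : ZMod 13) {y : ZMod 13 → ℂ} (hy : y.Odd) :
    dSum k (toV (chirp13 b y)) = dSum k (toV y) := by
  rw [dSum_toV, dSum_toV, projLinePair_d.lineSum_chirp k b hy]

theorem wSum_chirp (k : ℕ) (b : ZMod 13) {y : ZMod 13 → ℂ} (hy : y.Odd) :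
    wSum k (toV (chirp13 b y)) = wSum k (toV y) := by
  rw [wSum_toV, wSum_toV, projLinePair_w.lineSum_chirp k b hy]

theorem dSum_fourier (k : ℕ) {y : ZMod 13 → ℂ} (hy : y.Odd) :
    dSum k (toV (fourier13 y)) = 13 ^ (3 * k) * dSum k (toV y) := by
  rw [dSum_toV, dSum_toV, projLinePair_d.lineSum_fourier k hy, pow_mul]

theorem wSum_fourier (k : ℕ) {y : ZMod 13 → ℂ} (hy : y.Odd) :
    wSum k (toV (fourier13 y)) = 13 ^ (2 * k) * wSum k (toV y) := by
  rw [wSum_toV, wSum_toV, projLinePair_w.lineSum_fourier k hy, pow_mul]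

theorem dF_smul (n : ℕ) (c : ℂ) (v : Fin 6 → ℂ) : dF n (fun i ↦ c * v i) = c ^ 6 * dF n v := by
  have h0 : DD0 (fun i ↦ c * v i) = c ^ 3 * DD0 v := by simp only [DD0]; ring
  have h1 : DD1 (fun i ↦ c * v i) = c ^ 3 * DD1 v := by simp only [DD1]; ring
  have h2 : DD2 (fun i ↦ c * v i) = c ^ 3 * DD2 v := by simp only [DD2]; ring
  have h3 : DD3 (fun i ↦ c * v i) = c ^ 3 * DD3 v := by simp only [DD3]; ring
  have h4 : DD4 (fun i ↦ c * v i) = c ^ 3 * DD4 v := by simp only [DD4]; ring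
  have h5 : DD5 (fun i ↦ c * v i) = c ^ 3 * DD5 v := by simp only [DD5]; ring
  have h6 : DD6 (fun i ↦ c * v i) = c ^ 3 * DD6 v := by simp only [DD6]; ring
  have h7 : DD7 (fun i ↦ c * v i) = c ^ 3 * DD7 v := by simp only [DD7]; ring
  have h8 : DD8 (fun i ↦ c * v i) = c ^ 3 * DD8 v := by simp only [DD8]; ring
  have h9 : DD9 (fun i ↦ c * v i) = c ^ 3 * DD9 v := by simp only [DD9]; ring
  have h10 : DD10 (fun i ↦ c * v i) = c ^ 3 * DD10 v := by simp only [DD10]; ring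
  have h11 : DD11 (fun i ↦ c * v i) = c ^ 3 * DD11 v := by simp only [DD11]; ring
  have h12 : DD12 (fun i ↦ c * v i) = c ^ 3 * DD12 v := by simp only [DD12]; ring
  have hinf : DDinf (fun i ↦ c * v i) = c ^ 3 * DDinf v := by simp only [DDinf]; ring
  simp only [dF, GG0, GG1, GG2, GG3, GG4, GG5, GG6, GG7, GG8, GG9, GG10, GG11, GG12, h0, h1, h2,
    h3, h4, h5, h6, h7, h8, h9, h10, h11, h12, hinf]
  ring

theorem dSum_smul (k : ℕ) (c : ℂ) (v : Fin 6 → ℂ) :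
    dSum k (fun i ↦ c * v i) = c ^ (6 * k) * dSum k v := by
  have h : dInf (fun i ↦ c * v i) = c ^ 6 * dInf v := by
    simp only [dInf, GG0, DD0, DDinf]
    ring
  simp only [dSum, dF_smul, h, mul_pow, ← Finset.mul_sum, pow_mul]
  ring

theorem wSum_smul (k : ℕ) (c : ℂ) (v : Fin 6 → ℂ) :
    wSum k (fun i ↦ c * v i) = c ^ (4 * k) * wSum k v := by
  have h : wInf (fun i ↦ c * v i) = c ^ 4 * wInf v := by
    simp only [wInf, AA0]
    ring
  have h' (n : ℕ) : wF n (fun i ↦ c * v i) = c ^ 4 * wF n v := by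
    simp only [wF, AA0, AA1, AA2, AA3, AA4, AA5, AA6]
    ring
  simp only [wSum, h', h, mul_pow, ← Finset.mul_sum, pow_mul]
  ring

/-- The `n`-th term of the theta series `∑ q ^ (n² / 104)`. -/
def gaussTerm (n : ℤ) (z : ℂ) : ℂ := cexp (Real.pi * I * n ^ 2 * z / 52)

/-- The theta function of an odd residue system modulo `13`, twisted by `χ₄`. -/
def oddTheta (z : ℂ) (r : ZMod 13) : ℂ :=
  ∑' n : ℤ, if (n : ZMod 13) = r then (ZMod.χ₄ n : ℂ) * gaussTerm n z else 0

/-- The theta function of a residue class modulo `52`. -/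
def residueTheta (a : ℤ) (z : ℂ) : ℂ :=
  ∑' n : ℤ, if (n : ZMod 52) = a then gaussTerm n z else 0

theorem summable_gaussTerm {z : ℂ} (hz : 0 < z.im) : Summable (gaussTerm · z) := by
  have h : 0 < (z / 52).im := by
    rw [Complex.div_ofNat_im]
    positivity
  refine ((summable_jacobiTheta₂_term_iff 0 (z / 52)).2 h).congr fun n ↦ ?_
  rw [jacobiTheta₂_term, gaussTerm]
  ring_nf

theorem summable_mul_gaussTerm {z : ℂ} (hz : 0 < z.im) {c : ℤ → ℂ} (hc : ∀ n, ‖c n‖ ≤ 1) :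
    Summable (fun n ↦ c n * gaussTerm n z) := by
  refine Summable.of_norm_bounded (summable_gaussTerm hz).norm fun n ↦ ?_
  rw [norm_mul]
  exact mul_le_of_le_one_left (norm_nonneg _) (hc n)

theorem norm_chi_four_le (n : ZMod 4) : ‖(ZMod.χ₄ n : ℂ)‖ ≤ 1 := by
  have : ∀ n : ZMod 4, ZMod.χ₄ n = 0 ∨ ZMod.χ₄ n = 1 ∨ ZMod.χ₄ n = -1 := by decide
  rcases this n with h | h | h <;> simp [h]

theorem oddTheta_odd (z : ℂ) : (oddTheta z).Odd := by
  intro r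
  rw [oddTheta, oddTheta, ← (Equiv.neg ℤ).tsum_eq, ← tsum_neg]
  refine tsum_congr fun n ↦ ?_
  have : ZMod.χ₄ (-(n : ZMod 4)) = -ZMod.χ₄ n := by
    generalize (n : ZMod 4) = m
    revert m
    decide
  simp only [Equiv.neg_apply, Int.cast_neg, neg_inj, this, gaussTerm, neg_sq]
  split_ifs <;> ring

theorem residueTheta_eq (a : ℤ) (z : ℂ) :
    residueTheta a z = gaussTerm a z * jacobiTheta₂ (a * z) (52 * z) := by
  have hinj : Function.Injective (fun n : ℤ ↦ a + 52 * n) := fun m n h ↦ by simpa using h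
  rw [residueTheta, ← hinj.tsum_eq, jacobiTheta₂, ← tsum_mul_left]
  · refine tsum_congr fun n ↦ ?_
    have : ((a + 52 * n : ℤ) : ZMod 52) = a := by
      push_cast
      rw [show (52 : ZMod 52) = 0 from rfl, zero_mul, add_zero]
    rw [if_pos this, gaussTerm, gaussTerm, jacobiTheta₂_term, ← Complex.exp_add]
    congr 1
    push_cast
    ring
  · intro n hn
    have h : (n : ZMod 52) = a := by
      by_contra h
      simp [h] at hn
    obtain ⟨m, hm⟩ := (ZMod.intCast_eq_intCast_iff_dvd_sub _ _ 52).1 h.symm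
    exact ⟨m, by push_cast at hm; dsimp only; omega⟩

theorem residueTheta_inversion (a : ℤ) {z : ℂ} (hz : 0 < z.im) :
    residueTheta a z = 1 / (-I * (52 * z)) ^ (1 / 2 : ℂ) *
      ∑' n : ℤ, cexp (2 * Real.pi * I * (a * n) / 52) * gaussTerm n (-1 / z) := by
  have hz0 : z ≠ 0 := by
    rintro rfl
    simp at hz
  rw [residueTheta_eq, jacobiTheta₂_functional_equation, jacobiTheta₂, mul_comm (gaussTerm a z),
    mul_assoc, mul_assoc, mul_comm _ (gaussTerm a z), ← mul_assoc (cexp _)]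
  have h1 : cexp (-Real.pi * I * (a * z) ^ 2 / (52 * z)) * gaussTerm a z = 1 := by
    rw [gaussTerm, ← Complex.exp_add, Complex.exp_eq_one_iff]
    refine ⟨0, ?_⟩
    field_simp
    ring
  rw [h1, one_mul]
  congr 1
  refine tsum_congr fun n ↦ ?_
  rw [jacobiTheta₂_term, gaussTerm, ← Complex.exp_add]
  congr 1
  field_simp

theorem oddTheta_eq_residueTheta {z : ℂ} (hz : 0 < z.im) (r : ZMod 13) :
    oddTheta z r = residueTheta (40 * r.val + 13) z - residueTheta (40 * r.val - 13) z := by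
  have hs (a : ℤ) : Summable fun n : ℤ ↦ if (n : ZMod 52) = a then gaussTerm n z else 0 := by
    refine (summable_mul_gaussTerm hz (c := fun n : ℤ ↦ if (n : ZMod 52) = a then 1 else 0)
      fun n ↦ ?_).congr fun n ↦ ?_
    · split_ifs <;> simp
    · split_ifs <;> simp
  rw [oddTheta, residueTheta, residueTheta, ← (hs _).tsum_sub (hs _)]
  refine tsum_congr fun n ↦ ?_
  have key : ∀ m : ZMod 52, ∀ r : ZMod 13,
      (if (ZMod.castHom (show 13 ∣ 52 by norm_num) (ZMod 13) m) = r then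
        ZMod.χ₄ (ZMod.castHom (show 4 ∣ 52 by norm_num) (ZMod 4) m) else 0) =
      (if m = 40 * (r.val : ZMod 52) + 13 then 1 else 0)
        - (if m = 40 * (r.val : ZMod 52) - 13 then 1 else 0) := by
    decide
  have := key n r
  simp only [map_intCast] at this
  have h' : (if (n : ZMod 13) = r then (ZMod.χ₄ n : ℂ) * gaussTerm n z else 0) =
    ((if (n : ZMod 13) = r then ZMod.χ₄ n else 0 : ℤ) : ℂ) * gaussTerm n z := by
    split_ifs <;> simp
  rw [h', this]
  push_cast
  rw [sub_mul]
  simp only [ite_mul, one_mul, zero_mul]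

theorem I_zpow_sub (n : ℤ) : I ^ n - I ^ (-n) = 2 * I * (ZMod.χ₄ n : ℂ) := by
  have h4 : I ^ (4 : ℤ) = 1 := mod_cast I_pow_four
  have hq (q j : ℤ) : I ^ (4 * q + j) = I ^ j := by
    rw [zpow_add₀ I_ne_zero, zpow_mul, h4, one_zpow, one_mul]
  have hn : n = 4 * (n / 4) + n % 4 := (Int.mul_ediv_add_emod n 4).symm
  have h1 : I ^ n = I ^ (n % 4) := by
    conv_lhs => rw [hn]
    exact hq _ _
  have h2 : I ^ (-n) = I ^ (-(n % 4)) := by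
    conv_lhs => rw [hn]
    rw [neg_add, ← mul_neg]
    exact hq _ _
  rw [ZMod.χ₄_int_mod_four, h1, h2]
  have h0 := Int.emod_nonneg n (show (4 : ℤ) ≠ 0 by norm_num)
  have h3 := Int.emod_lt_of_pos n (show (0 : ℤ) < 4 by norm_num)
  have c0 : ZMod.χ₄ 0 = 0 := by decide
  have c1 : ZMod.χ₄ 1 = 1 := by decide
  have c2 : ZMod.χ₄ 2 = 0 := by decide
  have c3 : ZMod.χ₄ 3 = -1 := by decide
  have z2 : I ^ (2 : ℤ) = -1 := mod_cast I_sq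
  have z3 : I ^ (3 : ℤ) = -I := mod_cast I_pow_three
  generalize n % 4 = j at *
  interval_cases j
  · simp [c0]
  · simp [c1]
    ring
  · simp [c2, zpow_neg, z2]
  · simp [c3, zpow_neg, z3]
    ring

theorem exp_sub_exp_eq_chi_four (r : ZMod 13) (n : ℤ) :
    cexp (2 * Real.pi * I * ((40 * r.val + 13 : ℤ) * n) / 52)
      - cexp (2 * Real.pi * I * ((40 * r.val - 13 : ℤ) * n) / 52)
      = I * (2 * (ZMod.stdAddChar (10 * r * (n : ZMod 13)) * (ZMod.χ₄ n : ℂ))) := by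
  have h1 : cexp (2 * Real.pi * I * (40 * r.val * n) / 52)
      = ZMod.stdAddChar (10 * r * (n : ZMod 13)) := by
    have := ZMod.stdAddChar_coe (N := 13) (10 * r.val * n : ℤ)
    push_cast at this
    rw [ZMod.natCast_zmod_val] at this
    rw [this]
    congr 1
    ring
  have h2 (m : ℤ) : cexp (2 * Real.pi * I * (13 * m) / 52) = I ^ m := by
    rw [show I ^ m = cexp (Real.pi / 2 * I) ^ m by rw [Complex.exp_pi_div_two_mul_I],
      ← Complex.exp_int_mul]
    congr 1
    ring
  have e1 : cexp (2 * Real.pi * I * ((40 * r.val + 13 : ℤ) * n) / 52)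
      = ZMod.stdAddChar (10 * r * (n : ZMod 13)) * I ^ n := by
    rw [← h1, ← h2, ← Complex.exp_add]
    congr 1
    push_cast
    ring
  have e2 : cexp (2 * Real.pi * I * ((40 * r.val - 13 : ℤ) * n) / 52)
      = ZMod.stdAddChar (10 * r * (n : ZMod 13)) * I ^ (-n) := by
    rw [← h1, ← h2, ← Complex.exp_add]
    congr 1
    push_cast
    ring
  rw [e1, e2]
  linear_combination ZMod.stdAddChar (10 * r * (n : ZMod 13)) * I_zpow_sub n

theorem oddTheta_inversion {z : ℂ} (hz : 0 < z.im) :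
    oddTheta z = fun r ↦ 2 * I / (-I * (52 * z)) ^ (1 / 2 : ℂ) *
      fourier13 (oddTheta (-1 / z)) r := by
  have hz' : 0 < (-1 / z).im := by
    rw [neg_div, neg_im, one_div, inv_im, neg_div, neg_neg]
    refine div_pos hz (normSq_pos.2 ?_)
    rintro rfl
    simp at hz
  have hnorm (x : ℝ) : ‖cexp (2 * Real.pi * I * x)‖ ≤ 1 := by
    rw [show 2 * Real.pi * I * (x : ℂ) = ((2 * Real.pi * x : ℝ) : ℂ) * I by push_cast; ring,
      Complex.norm_exp_ofReal_mul_I]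
  have hs (a : ℤ) : Summable fun n : ℤ ↦ cexp (2 * Real.pi * I * (a * n) / 52) *
      gaussTerm n (-1 / z) :=
    summable_mul_gaussTerm hz' fun n ↦ by
      refine le_of_eq_of_le ?_ (hnorm (a * n / 52))
      push_cast
      ring_nf
  ext r
  have hf : fourier13 (oddTheta (-1 / z)) r = ∑' n : ℤ,
      ZMod.stdAddChar (10 * r * (n : ZMod 13)) * (ZMod.χ₄ n : ℂ) * gaussTerm n (-1 / z) := by
    simp only [fourier13, oddTheta, ← tsum_mul_left]
    rw [← Summable.tsum_finsetSum]
    · refine tsum_congr fun n ↦ ?_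
      simp only [mul_ite, mul_zero]
      rw [Finset.sum_ite_eq]
      simp [mul_assoc]
    · intro s _
      refine (summable_mul_gaussTerm hz' (c := fun n : ℤ ↦ if (n : ZMod 13) = s then
        (ZMod.χ₄ n : ℂ) else 0) fun n ↦ ?_).congr (fun n ↦ ?_) |>.mul_left _
      · split_ifs
        · exact norm_chi_four_le _
        · simp
      · split_ifs <;> simp
  have key : (∑' n : ℤ, cexp (2 * Real.pi * I * ((40 * r.val + 13 : ℤ) * n) / 52) *
      gaussTerm n (-1 / z)) - (∑' n : ℤ, cexp (2 * Real.pi * I * ((40 * r.val - 13 : ℤ) * n) / 52) *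
      gaussTerm n (-1 / z)) = 2 * I * fourier13 (oddTheta (-1 / z)) r := by
    rw [← (hs _).tsum_sub (hs _), hf, ← tsum_mul_left]
    refine tsum_congr fun n ↦ ?_
    linear_combination gaussTerm n (-1 / z) * exp_sub_exp_eq_chi_four r n
  rw [oddTheta_eq_residueTheta hz, residueTheta_inversion _ hz, residueTheta_inversion _ hz,
    ← mul_sub, key]
  ring

theorem oddTheta_add_one (z : ℂ) :
    oddTheta (z + 1) = fun r ↦ cexp (2 * Real.pi * I * (5 / 8)) * chirp13 1 (oddTheta z) r := by
  ext r
  simp only [oddTheta, chirp13, ← tsum_mul_left]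
  refine tsum_congr fun n ↦ ?_
  split_ifs with h
  · rcases Int.even_or_odd n with he | ho
    · have : ZMod.χ₄ n = 0 := by rw [ZMod.χ₄_int_eq_if_mod_four, if_pos (Int.even_iff.1 he)]
      simp [this]
    · obtain ⟨m, hm⟩ : ∃ m, n ^ 2 = 8 * m + 1 := by
        obtain ⟨k, rfl⟩ := ho
        obtain ⟨j, hj⟩ := Int.even_mul_succ_self k
        exact ⟨j, by linear_combination 4 * hj⟩
      have hm' : (n : ℂ) ^ 2 = 8 * m + 1 := mod_cast hm
      have : gaussTerm n (z + 1) = cexp (2 * Real.pi * I * (5 / 8)) *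
          ZMod.stdAddChar (5 * (n : ZMod 13) ^ 2) * gaussTerm n z := by
        have hc := ZMod.stdAddChar_coe (N := 13) (5 * n ^ 2 : ℤ)
        push_cast at hc
        rw [hc, gaussTerm, gaussTerm, ← Complex.exp_add, ← Complex.exp_add,
            Complex.exp_eq_exp_iff_exists_int]
        refine ⟨n ^ 2 * (-1) + 5 * m, ?_⟩
        push_cast
        linear_combination 5 * Real.pi * I / 4 * hm'
      rw [this, ← h]
      ring_nf
  · simp

theorem differentiableAt_oddTheta {z : ℂ} (hz : 0 < z.im) (r : ZMod 13) :
    DifferentiableAt ℂ (fun z ↦ oddTheta z r) z := by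
  have hres (a : ℤ) : DifferentiableAt ℂ (residueTheta a) z := by
    have : residueTheta a = fun z ↦ gaussTerm a z * jacobiTheta₂ (a * z) (52 * z) :=
      funext (residueTheta_eq a)
    rw [this]
    have him : 0 < (52 * z).im := by
      simp only [mul_im, re_ofNat, im_ofNat]
      linarith
    have h2 := (hasFDerivAt_jacobiTheta₂ (a * z) him).differentiableAt
    have h3 : DifferentiableAt ℂ (fun z : ℂ ↦ ((a * z : ℂ), (52 * z : ℂ))) z := by fun_prop
    have h4 : DifferentiableAt ℂ (fun z ↦ jacobiTheta₂ (a * z) (52 * z)) z :=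
      DifferentiableAt.comp (g := fun p : ℂ × ℂ ↦ jacobiTheta₂ p.1 p.2) z h2 h3
    refine DifferentiableAt.mul ?_ h4
    unfold gaussTerm
    fun_prop
  have hev : (fun z ↦ oddTheta z r) =ᶠ[nhds z] fun z ↦
      residueTheta (40 * r.val + 13) z - residueTheta (40 * r.val - 13) z := by
    filter_upwards [(isOpen_lt continuous_const continuous_im).mem_nhds hz] with w hw
    exact oddTheta_eq_residueTheta hw r
  exact ((hres _).sub (hres _)).congr_of_eventuallyEq hev

theorem th13_eq_oddTheta (k : ℤ) (hk : Odd k) (c : ℚ) (hc : c = k ^ 2 / 104) (z : ℂ) :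
    th13 c k z = ZMod.χ₄ k * oddTheta z k := by
  have hinj : Function.Injective (fun n : ℤ ↦ 26 * n + k) := fun m n h ↦ by simpa using h
  have hsum : oddTheta z k = ∑' n : ℤ, (ZMod.χ₄ (26 * n + k : ℤ) : ℂ) * gaussTerm (26 * n
      + k) z := by
    rw [oddTheta, ← hinj.tsum_eq]
    · refine tsum_congr fun n ↦ ?_
      have h1 : ((26 * n + k : ℤ) : ZMod 13) = k := by
        push_cast
        rw [show (26 : ZMod 13) = 0 from rfl, zero_mul, zero_add]
      rw [if_pos h1]
    · intro n hn
      have h : (n : ZMod 13) = k := by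
        by_contra h
        simp [h] at hn
      have h' : Odd n := by
        by_contra he
        have : ZMod.χ₄ n = 0 := by
          rw [ZMod.χ₄_int_eq_if_mod_four, if_pos (Int.even_iff.1 (Int.not_odd_iff_even.1 he))]
        rw [Function.mem_support, this] at hn
        simp at hn
      obtain ⟨m, hm⟩ := (ZMod.intCast_eq_intCast_iff_dvd_sub _ _ 13).1 h.symm
      obtain ⟨a, ha⟩ := h'
      obtain ⟨b, hb⟩ := hk
      refine ⟨m / 2, ?_⟩
      push_cast at hm
      dsimp only
      omega
  rw [th13, hsum, ← tsum_mul_left, ← tsum_mul_left]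
  refine tsum_congr fun n ↦ ?_
  have h2 : (ZMod.χ₄ k : ℂ) * (ZMod.χ₄ (26 * n + k : ℤ) : ℂ) = (-1) ^ n := by
    have h4 : ((26 * n + k : ℤ) : ZMod 4) = 2 * n + k := by
      push_cast
      rw [show (26 : ZMod 4) = 2 from rfl]
    have hkey : ∀ a b : ZMod 4, 2 * a = 2 → 2 * b = 0 → ZMod.χ₄ a * ZMod.χ₄ (2 * b + a) = 1 := by
      decide
    have hkey' : ∀ a b : ZMod 4, 2 * a = 2 → 2 * b = 2 → ZMod.χ₄ a * ZMod.χ₄ (2 * b + a) = -1 := by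
      decide
    have hodd (m : ℤ) (hm : Odd m) : (2 * m : ZMod 4) = 2 := by
      obtain ⟨j, rfl⟩ := hm
      push_cast
      generalize (j : ZMod 4) = j
      revert j
      decide
    rw [h4]
    rcases Int.even_or_odd n with hn | hn
    · rw [hn.neg_one_zpow]
      have : (2 * n : ZMod 4) = 0 := by
        obtain ⟨j, rfl⟩ := hn
        push_cast
        generalize (j : ZMod 4) = j
        revert j
        decide
      exact mod_cast hkey k n (hodd k hk) this
    · rw [hn.neg_one_zpow]
      exact mod_cast hkey' k n (hodd k hk) (hodd n hn)
  rw [← mul_assoc (ZMod.χ₄ k : ℂ), h2, gaussTerm, mul_left_comm, ← Complex.exp_add]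
  congr 2
  rw [hc]
  push_cast
  ring

theorem ta_eq_toV (z : ℂ) : (fun i ↦ ta i z) = toV (oddTheta z) := by
  have ho := oddTheta_odd z
  have c3 : ZMod.χ₄ ((3 : ℤ) : ZMod 4) = -1 := by decide
  have c5 : ZMod.χ₄ ((5 : ℤ) : ZMod 4) = 1 := by decide
  have c7 : ZMod.χ₄ ((7 : ℤ) : ZMod 4) = -1 := by decide
  have c9 : ZMod.χ₄ ((9 : ℤ) : ZMod 4) = 1 := by decide
  have c11 : ZMod.χ₄ ((11 : ℤ) : ZMod 4) = -1 := by decide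
  have t11 := th13_eq_oddTheta 11 (by decide) (121 / 104) (by norm_num) z
  have t7 := th13_eq_oddTheta 7 (by decide) (49 / 104) (by norm_num) z
  have t5 := th13_eq_oddTheta 5 (by decide) (25 / 104) (by norm_num) z
  have t3 := th13_eq_oddTheta 3 (by decide) (9 / 104) (by norm_num) z
  have t9 := th13_eq_oddTheta 9 (by decide) (81 / 104) (by norm_num) z
  have t1 := th13_eq_oddTheta 1 (by decide) (1 / 104) (by norm_num) z
  have c1 : ZMod.χ₄ ((1 : ℤ) : ZMod 4) = 1 := by decide
  rw [c1] at t1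
  rw [c11] at t11
  rw [c7] at t7
  rw [c5] at t5
  rw [c3] at t3
  rw [c9] at t9
  obtain ⟨v1, v2, v3, v4, v5, v6⟩ := Function.Odd.values ho
  push_cast at t11 t7 t5 t3 t9 t1
  ext i
  norm_num at t11 t7 t5 t3 t9 t1
  rw [one_div] at t1
  fin_cases i <;> simp [ta, toV, *]

open UpperHalfPlane ModularForm MatrixGroups Filter Topology SlashInvariantForm in
/-- A holomorphic function on the upper half-plane with the invariance properties of a modular form
of level one and weight `k < 12` is determined by its value at the cusp. -/
theorem eq_modularForm_of_tendsto {k : ℤ} (hk : k < 12) {f : ℂ → ℂ}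
    (hf : ∀ z : ℂ, 0 < z.im → DifferentiableAt ℂ f z)
    (hT : ∀ z : ℂ, 0 < z.im → f (z + 1) = f z)
    (hS : ∀ z : ℂ, 0 < z.im → f (-1 / z) = z ^ k * f z) {l : ℂ}
    (hl : Tendsto f (comap Complex.im atTop) (𝓝 l)) (g : ModularForm 𝒮ℒ k)
    (hg : Tendsto g atImInfty (𝓝 l)) (z : ℍ) : f z = g z := by
  have hg' (γ : SL(2, ℤ)) : (g : ℍ → ℂ) ∣[k] γ = g := g.slash_action_eq' _ ⟨γ, rfl⟩
  have hfS : (fun τ : ℍ ↦ f τ) ∣[k] ModularGroup.S = fun τ : ℍ ↦ f τ := by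
    ext τ
    rw [SL_slash_apply, UpperHalfPlane.modular_S_smul, ModularGroup.denom_S]
    have : f (-(τ : ℂ))⁻¹ = (τ : ℂ) ^ k * f τ := by
      rw [← hS τ τ.2]
      congr 1
      rw [inv_neg, neg_div, one_div]
    rw [UpperHalfPlane.coe_mk, this, mul_right_comm, ← zpow_add₀ τ.ne_zero, add_neg_cancel,
        zpow_zero, one_mul]
  have hfT : (fun τ : ℍ ↦ f τ) ∣[k] ModularGroup.T = fun τ : ℍ ↦ f τ := by
    ext τ
    rw [SL_slash_apply, UpperHalfPlane.modular_T_smul, ModularGroup.denom_apply]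
    have : f (1 + τ) = f τ := by rw [add_comm, hT τ τ.2]
    simp [ModularGroup.coe_T, this]
  have hslash (γ : SL(2, ℤ)) : (fun τ : ℍ ↦ f τ - g τ) ∣[k] γ = fun τ : ℍ ↦ f τ - g τ := by
    have := slash_action_generators_SL2Z hfS hfT γ
    change ((fun τ : ℍ ↦ f τ) - (g : ℍ → ℂ)) ∣[k] γ = (fun τ : ℍ ↦ f τ) - (g : ℍ → ℂ)
    rw [sub_eq_add_neg, SlashAction.add_slash, this, SlashAction.neg_slash, hg']
  let F : CuspForm 𝒮ℒ k :=
    { toFun := fun τ ↦ f τ - g τ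
      slash_action_eq' := by
        rintro _ ⟨γ, rfl⟩
        exact hslash γ
      holo' := by
        refine MDifferentiable.sub ?_ g.holo'
        rw [UpperHalfPlane.mdifferentiable_iff]
        refine .congr (fun z hz ↦ (hf z hz).differentiableWithinAt) fun z hz ↦ ?_
        simp [ofComplex_apply_of_im_pos hz]
      zero_at_cusps' := by
        intro c hc
        rw [Subgroup.IsArithmetic.isCusp_iff_isCusp_SL2Z] at hc
        rw [OnePoint.isZeroAt_iff_forall_SL2Z hc]
        intro γ _
        rw [hslash]
        have := (hl.comp tendsto_coe_atImInfty).sub hg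
        rwa [sub_self] at this }
  have h0 : F = 0 :=
    rank_zero_iff_forall_zero.1 (CuspForm.rank_eq_zero_of_weight_lt_twelve hk) F
  have : F z = 0 := by rw [h0]; rfl
  exact sub_eq_zero.1 this

open UpperHalfPlane ModularForm MatrixGroups Filter Topology in
theorem tendsto_E_atImInfty {k : ℕ} (hk : 3 ≤ k) (hk' : Even k) :
    Tendsto (E hk) atImInfty (𝓝 1) := by
  have h1 := one_mem_strictPeriods_SL
  have hanal := ModularFormClass.analyticAt_cuspFunction_zero (E hk) one_pos h1
  have hper := SlashInvariantFormClass.periodic_comp_ofComplex (E hk) h1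
  have hq := EisensteinSeries.E_qExpansion_coeff_zero hk hk'
  rw [UpperHalfPlane.qExpansion_coeff_zero one_pos hanal hper] at hq
  rw [← hq, ← UpperHalfPlane.cuspFunction_apply_zero one_pos hanal hper]
  exact (hanal.continuousAt.tendsto.comp (qParam_tendsto_atImInfty one_pos)).congr
    (fun τ ↦ SlashInvariantFormClass.eq_cuspFunction (E hk) τ h1 one_ne_zero)

theorem etaF_eq_eta (z : ℂ) : etaF z = ModularForm.eta z := by
  rw [etaF, ModularForm.eta, Function.Periodic.qParam]
  simp only [ModularForm.eta_q_eq_pow]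
  norm_num

/-- The neighbourhoods of the cusp `i∞`. -/
def atCusp : Filter ℂ := Filter.comap Complex.im Filter.atTop

open Filter Topology in
theorem tendsto_eta_tprod :
    Tendsto (fun z : ℂ ↦ ∏' n : ℕ, (1 - cexp (2 * Real.pi * I * z) ^ (n + 1))) atCusp (𝓝 1) := by
  have hcont : ContinuousAt (fun q : ℂ ↦ ∏' n : ℕ, (1 - q ^ (n + 1))) 0 :=
    (ModularForm.differentiableOn_tprod_one_sub_pow.differentiableAt
      (Metric.isOpen_ball.mem_nhds (by simp))).continuousAt
  have hq : Tendsto (fun z : ℂ ↦ cexp (2 * Real.pi * I * z)) atCusp (𝓝 0) := by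
    have := (Function.Periodic.qParam_tendsto (h := 1) one_pos).mono_right nhdsWithin_le_nhds
    refine this.congr fun z ↦ ?_
    simp [Function.Periodic.qParam]
  have := hcont.tendsto.comp hq
  simpa [Function.comp_def] using this

theorem etaF_add_one (z : ℂ) : etaF (z + 1) = cexp (2 * Real.pi * I / 24) * etaF z := by
  have h : cexp (2 * Real.pi * I * (z + 1)) = cexp (2 * Real.pi * I * z) := by
    rw [mul_add, mul_one, Complex.exp_add, Complex.exp_two_pi_mul_I, mul_one]
  rw [etaF, etaF, h, ← mul_assoc, ← Complex.exp_add]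
  congr 2
  ring

theorem etaF_neg_inv_sq {z : ℂ} (hz : 0 < z.im) :
    etaF (-1 / z) ^ 2 = -I * z * etaF z ^ 2 := by
  have h := ModularForm.eta_comp_eq_csqrt_I_inv hz
  have hz0 : z ≠ 0 := by
    rintro rfl
    simp at hz
  have hs (w : ℂ) (hw : w ≠ 0) : Complex.sqrt w ^ 2 = w := by
    rw [_root_.sqrt_eq_exp hw, ← Complex.exp_nat_mul]
    rw [show ((2 : ℕ) : ℂ) * (Complex.log w / 2) = Complex.log w by push_cast; ring,
      Complex.exp_log hw]
  simp only [Function.comp_apply, Pi.smul_apply, Pi.mul_apply, smul_eq_mul] at h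
  rw [etaF_eq_eta, etaF_eq_eta, h, mul_pow, mul_pow, inv_pow, hs _ hz0, hs _ I_ne_zero,
      Complex.inv_I]
  ring

theorem xV_eq_toV (z : ℂ) : xV z = toV fun r ↦ etaF z * oddTheta z r := by
  rw [toV_smul, ← ta_eq_toV]
  rfl

theorem xV_add_one (z : ℂ) : xV (z + 1) =
    fun i ↦ cexp (2 * Real.pi * I * (2 / 3)) * toV (chirp13 1 fun r ↦ etaF z * oddTheta z r) i := by
  rw [xV_eq_toV, etaF_add_one, oddTheta_add_one, ← toV_smul]
  congr 1
  ext r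
  have : cexp (2 * Real.pi * I * (2 / 3)) =
      cexp (2 * Real.pi * I / 24) * cexp (2 * Real.pi * I * (5 / 8)) := by
    rw [← Complex.exp_add]
    congr 1
    ring
  simp only [chirp13, this]
  ring

theorem exists_xV_neg_inv {z : ℂ} (hz : 0 < z.im) : ∃ c : ℂ, 13 * c ^ 2 = z ^ 2 ∧ xV (-1 / z) =
    fun i ↦ c * toV (fourier13 fun r ↦ etaF z * oddTheta z r) i := by
  have hz0 : z ≠ 0 := by
    rintro rfl
    simp at hz
  have hz' : 0 < (-1 / z).im := by
    rw [neg_div, neg_im, one_div, inv_im, neg_div, neg_neg]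
    exact div_pos hz (normSq_pos.2 hz0)
  have hw : -1 / (-1 / z) = z := by field_simp
  have he0 : etaF z ≠ 0 := by
    rw [etaF_eq_eta]
    exact ModularForm.eta_ne_zero hz
  refine ⟨etaF (-1 / z) / etaF z * (2 * I / (-I * (52 * (-1 / z))) ^ (1 / 2 : ℂ)), ?_, ?_⟩
  · rw [mul_pow, div_pow, div_pow, etaF_neg_inv_sq hz, ← Complex.cpow_nat_mul]
    norm_num
    field_simp
    ring_nf
    simp only [I_sq]
    ring
  · rw [xV_eq_toV, oddTheta_inversion hz', hw, ← toV_smul]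
    congr 1
    ext r
    simp only [fourier13, Finset.mul_sum]
    refine Finset.sum_congr rfl fun s _ ↦ ?_
    field_simp

theorem odd_smul_oddTheta (c z : ℂ) : (fun r ↦ c * oddTheta z r).Odd := fun r ↦ by
  simp only [oddTheta_odd z r, mul_neg]

theorem cexp_two_thirds_pow_three : cexp (2 * Real.pi * I * (2 / 3)) ^ 3 = 1 := by
  rw [← Complex.exp_nat_mul, Complex.exp_eq_one_iff]
  refine ⟨2, ?_⟩
  push_cast
  ring

theorem dSum_xV_add_one (k : ℕ) (z : ℂ) : dSum k (xV (z + 1)) = dSum k (xV z) := by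
  rw [xV_add_one, dSum_smul, dSum_chirp k 1 (odd_smul_oddTheta _ z), ← xV_eq_toV,
    show 6 * k = 3 * (2 * k) by ring, pow_mul, cexp_two_thirds_pow_three, one_pow, one_mul]

theorem dSum_xV_neg_inv (k : ℕ) {z : ℂ} (hz : 0 < z.im) :
    dSum k (xV (-1 / z)) = z ^ (6 * k) * dSum k (xV z) := by
  obtain ⟨c, hc, h⟩ := exists_xV_neg_inv hz
  rw [h, dSum_smul, dSum_fourier k (odd_smul_oddTheta _ z), ← xV_eq_toV,
    show 6 * k = 2 * (3 * k) by ring, pow_mul, pow_mul z, ← hc, mul_pow]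
  ring

theorem wSum_xV_add_one (k : ℕ) (z : ℂ) :
    wSum k (xV (z + 1)) = cexp (2 * Real.pi * I * (2 / 3)) ^ (4 * k) * wSum k (xV z) := by
  rw [xV_add_one, wSum_smul, wSum_chirp k 1 (odd_smul_oddTheta _ z), ← xV_eq_toV]

theorem wSum_xV_neg_inv (k : ℕ) {z : ℂ} (hz : 0 < z.im) :
    wSum k (xV (-1 / z)) = z ^ (4 * k) * wSum k (xV z) := by
  obtain ⟨c, hc, h⟩ := exists_xV_neg_inv hz
  rw [h, wSum_smul, wSum_fourier k (odd_smul_oddTheta _ z), ← xV_eq_toV,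
    show 4 * k = 2 * (2 * k) by ring, pow_mul, pow_mul z, ← hc, mul_pow]
  ring

theorem etaF_ne_zero {z : ℂ} (hz : 0 < z.im) : etaF z ≠ 0 := by
  rw [etaF_eq_eta]
  exact ModularForm.eta_ne_zero hz

theorem differentiableAt_etaF {z : ℂ} (hz : 0 < z.im) : DifferentiableAt ℂ etaF z := by
  rw [funext etaF_eq_eta]
  exact ModularForm.differentiableAt_eta_of_mem_upperHalfPlaneSet hz

theorem differentiableAt_xV {z : ℂ} (hz : 0 < z.im) (i : Fin 6) :
    DifferentiableAt ℂ (fun z ↦ xV z i) z := by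
  have h (r : ZMod 13) := (differentiableAt_etaF hz).mul (differentiableAt_oddTheta hz r)
  simp only [xV_eq_toV, toV]
  fin_cases i
  exacts [h 2, h 6, h 5, h 3, h 9, h 1]

theorem etaF_pow_eight_add_one (z : ℂ) :
    etaF (z + 1) ^ 8 = cexp (2 * Real.pi * I * (2 / 3)) ^ 20 * etaF z ^ 8 := by
  rw [etaF_add_one, mul_pow, show 20 = 3 * 6 + 2 by norm_num, pow_add, pow_mul,
    cexp_two_thirds_pow_three, one_pow, one_mul]
  congr 1
  rw [← Complex.exp_nat_mul, ← Complex.exp_nat_mul, Complex.exp_eq_exp_iff_exists_int]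
  refine ⟨-1, ?_⟩
  push_cast
  ring

theorem etaF_pow_twentyfour_add_one (z : ℂ) : etaF (z + 1) ^ 24 = etaF z ^ 24 := by
  rw [show 24 = 8 * 3 by norm_num, pow_mul, pow_mul, etaF_pow_eight_add_one, mul_pow, ← pow_mul,
    mul_comm 20, pow_mul, cexp_two_thirds_pow_three, one_pow, one_mul]

theorem etaF_neg_inv_pow_eight {z : ℂ} (hz : 0 < z.im) :
    etaF (-1 / z) ^ 8 = z ^ 4 * etaF z ^ 8 := by
  rw [show 8 = 2 * 4 by norm_num, pow_mul, pow_mul, etaF_neg_inv_sq hz]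
  ring_nf
  simp

theorem differentiableAt_comp_xV {P : (Fin 6 → ℂ) → ℂ} (hP : Differentiable ℂ P) {z : ℂ}
    (hz : 0 < z.im) : DifferentiableAt ℂ (fun z ↦ P (xV z)) z :=
  (hP _).comp z (differentiableAt_pi.2 (differentiableAt_xV hz))

theorem differentiable_dSum (k : ℕ) : Differentiable ℂ (dSum k) := by
  unfold dSum dF dInf GG0 GG1 GG2 GG3 GG4 GG5 GG6 GG7 GG8 GG9 GG10 GG11 GG12 DD0 DD1 DD2 DD3 DD4
      DD5 DD6 DD7 DD8 DD9 DD10 DD11 DD12 DDinf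
  fun_prop

theorem differentiable_wSum (k : ℕ) : Differentiable ℂ (wSum k) := by
  unfold wSum wF wInf AA0 AA1 AA2 AA3 AA4 AA5 AA6
  fun_prop

section

open Filter Topology

theorem norm_gaussTerm_div (n m : ℤ) (z : ℂ) :
    ‖gaussTerm n z / gaussTerm m z‖ = Real.exp (-(Real.pi / 52 * (n ^ 2 - m ^ 2 : ℤ) * z.im)) := by
  rw [gaussTerm, gaussTerm, ← Complex.exp_sub, Complex.norm_exp]
  congr 1
  rw [show (Real.pi * I * n ^ 2 * z / 52 - Real.pi * I * m ^ 2 * z / 52 : ℂ) =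
    ((Real.pi / 52 * (n ^ 2 - m ^ 2 : ℤ) : ℝ) : ℂ) * (I * z) by push_cast; ring]
  rw [re_ofReal_mul, I_mul_re]
  ring

theorem tendsto_gaussTerm_div {n m : ℤ} (h : m ^ 2 < n ^ 2) :
    Tendsto (fun z ↦ gaussTerm n z / gaussTerm m z) atCusp (𝓝 0) := by
  rw [tendsto_zero_iff_norm_tendsto_zero]
  simp only [norm_gaussTerm_div]
  refine Real.tendsto_exp_neg_atTop_nhds_zero.comp (Tendsto.const_mul_atTop ?_ tendsto_comap)
  have : (0 : ℝ) < (n ^ 2 - m ^ 2 : ℤ) := mod_cast sub_pos.2 h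
  positivity

theorem sq_lt_sq_of_residue {n m : ℤ} (hm : |m| < 13) (hn : Odd n) (hm' : Odd m)
    (h : (n : ZMod 13) = m) (hne : n ≠ m) : m ^ 2 < n ^ 2 := by
  obtain ⟨k, hk⟩ := (ZMod.intCast_eq_intCast_iff_dvd_sub _ _ 13).1 h
  obtain ⟨a, rfl⟩ := hn
  obtain ⟨b, rfl⟩ := hm'
  rw [sq_lt_sq]
  rw [abs_lt] at hm
  push_cast at hk
  rcases lt_trichotomy k 0 with h | h | h
  · rw [abs_lt, lt_abs, neg_lt, lt_abs]
    omega
  · omega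
  · rw [abs_lt, lt_abs, neg_lt, lt_abs]
    omega

/-- The leading term of `oddTheta` at the cusp. -/
theorem tendsto_oddTheta_div {m : ℤ} (hm : |m| < 13) (hodd : Odd m) :
    Tendsto (fun z ↦ oddTheta z m / gaussTerm m z) atCusp (𝓝 (ZMod.χ₄ m : ℂ)) := by
  have hχ (n : ℤ) (hn : ¬ Odd n) : ZMod.χ₄ n = 0 := by
    rw [ZMod.χ₄_int_eq_if_mod_four, if_pos (Int.even_iff.1 (Int.not_odd_iff_even.1 hn))]
  have h0 (z : ℂ) : gaussTerm m z ≠ 0 := Complex.exp_ne_zero _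
  have hlim (n : ℤ) : Tendsto (fun z ↦ (if (n : ZMod 13) = m then (ZMod.χ₄ n : ℂ) *
      (gaussTerm n z / gaussTerm m z) else 0)) atCusp (𝓝 (if n =
          m then (ZMod.χ₄ m : ℂ) else 0)) := by
    by_cases hnm : n = m
    · subst hnm
      simp only [if_true, div_self (h0 _), mul_one]
      exact tendsto_const_nhds
    rw [if_neg hnm]
    by_cases hn : Odd n
    · by_cases hr : (n : ZMod 13) = m
      · simpa [hr] using (tendsto_gaussTerm_div (sq_lt_sq_of_residue hm hn hodd hr hnm)).const_mul
          (ZMod.χ₄ n : ℂ)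
      · simp only [hr, if_false]
        exact tendsto_const_nhds
    · simp only [hχ n hn, Int.cast_zero, zero_mul, ite_self]
      exact tendsto_const_nhds
  have hbound : ∀ᶠ z in atCusp, ∀ n : ℤ, ‖(if (n : ZMod 13) = m then (ZMod.χ₄ n : ℂ) *
      (gaussTerm n z / gaussTerm m z) else 0)‖ ≤ ‖gaussTerm n I / gaussTerm m I‖ := by
    filter_upwards [preimage_mem_comap (eventually_ge_atTop (1 : ℝ))] with z hz n
    by_cases hn : Odd n
    · by_cases hr : (n : ZMod 13) = m
      · rw [if_pos hr, norm_mul]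
        refine (mul_le_of_le_one_left (norm_nonneg _) (norm_chi_four_le n)).trans ?_
        rw [norm_gaussTerm_div, norm_gaussTerm_div, Real.exp_le_exp, neg_le_neg_iff, I_im]
        refine mul_le_mul_of_nonneg_left hz ?_
        have : (0 : ℝ) ≤ (n ^ 2 - m ^ 2 : ℤ) := by
          rcases eq_or_ne n m with rfl | hnm
          · simp
          · exact mod_cast (sub_pos.2 (sq_lt_sq_of_residue hm hn hodd hr hnm)).le
        positivity
      · rw [if_neg hr, norm_zero]
        positivity
    · simp only [hχ n hn, Int.cast_zero, zero_mul, ite_self, norm_zero]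
      positivity
  have hsum : Summable fun n : ℤ ↦ ‖gaussTerm n I / gaussTerm m I‖ :=
    ((summable_gaussTerm (by simp)).div_const _).norm
  have := tendsto_tsum_of_dominated_convergence hsum hlim hbound
  rw [tsum_ite_eq] at this
  refine this.congr fun z ↦ ?_
  rw [oddTheta, ← tsum_div_const]
  refine tsum_congr fun n ↦ ?_
  split_ifs <;> ring

/-- The exponents of `q ^ (1 / 13)` in the theta constants, relative to `q ^ (1 / 104)`. -/
def thetaExp : Fin 6 → ℕ := ![15, 6, 3, 1, 10, 0]

/-- The leading coefficients of the theta constants. -/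
def thetaSign : Fin 6 → ℂ := ![1, 1, 1, -1, 1, 1]

/-- The local parameter `q ^ (1 / 13)`. -/
def cuspParam (z : ℂ) : ℂ := cexp (2 * Real.pi * I * z / 13)

/-- The theta constants with their leading powers of `q` removed. -/
def thetaUnit (z : ℂ) (i : Fin 6) : ℂ :=
  ta i z / (gaussTerm 1 z * cuspParam z ^ thetaExp i)

theorem gaussTerm_eq (n : ℤ) (k : ℕ) (h : n ^ 2 = 1 + 8 * k) (z : ℂ) :
    gaussTerm n z = gaussTerm 1 z * cuspParam z ^ k := by
  rw [gaussTerm, gaussTerm, cuspParam, ← Complex.exp_nat_mul, ← Complex.exp_add]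
  congr 1
  have h' : (n : ℂ) ^ 2 = 1 + 8 * k := mod_cast h
  rw [h']
  push_cast
  ring

theorem cuspParam_ne_zero (z : ℂ) : cuspParam z ≠ 0 := Complex.exp_ne_zero _

theorem tendsto_cuspParam : Tendsto cuspParam atCusp (𝓝 0) := by
  have := (Function.Periodic.qParam_tendsto (h := 13) (by norm_num)).mono_right nhdsWithin_le_nhds
  refine this.congr fun z ↦ ?_
  simp [Function.Periodic.qParam, cuspParam]

theorem tendsto_thetaUnit : Tendsto thetaUnit atCusp (𝓝 thetaSign) := by
  have key (m : ℤ) (k : ℕ) (hm : |m| < 13) (hodd : Odd m) (h : m ^ 2 = 1 + 8 * k) (c : ℤ)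
      (hc : ZMod.χ₄ m = c) :
      Tendsto (fun z ↦ oddTheta z m / (gaussTerm 1 z * cuspParam z ^ k)) atCusp (𝓝 (c : ℂ)) := by
    rw [← hc]
    exact (tendsto_oddTheta_div hm hodd).congr fun z ↦ by rw [gaussTerm_eq m k h]
  have h₁ := key (-11) 15 (by norm_num) (by decide) (by norm_num) 1 (by decide)
  have h₂ := key (-7) 6 (by norm_num) (by decide) (by norm_num) 1 (by decide)
  have h₃ := key 5 3 (by norm_num) (by decide) (by norm_num) 1 (by decide)
  have h₄ := key 3 1 (by norm_num) (by decide) (by norm_num) (-1) (by decide)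
  have h₅ := key 9 10 (by norm_num) (by decide) (by norm_num) 1 (by decide)
  have h₆ := key 1 0 (by norm_num) (by decide) (by norm_num) 1 (by decide)
  rw [show ((-11 : ℤ) : ZMod 13) = 2 from by decide] at h₁
  rw [show ((-7 : ℤ) : ZMod 13) = 6 from by decide] at h₂
  push_cast at h₁ h₂ h₃ h₄ h₅ h₆
  have h (z : ℂ) (i : Fin 6) : ta i z = toV (oddTheta z) i := congrFun (ta_eq_toV z) i
  rw [tendsto_pi_nhds]
  simp only [Fin.forall_fin_succ, thetaUnit, h, toV, thetaExp, thetaSign]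
  refine ⟨h₁, h₂, h₃, h₄, h₅, h₆, fun i ↦ i.elim0⟩

theorem xV_eq_thetaUnit (z : ℂ) : xV z =
    fun i ↦ etaF z * gaussTerm 1 z * (cuspParam z ^ thetaExp i * thetaUnit z i) := by
  ext i
  have h0 : gaussTerm 1 z ≠ 0 := Complex.exp_ne_zero _
  have h1 := cuspParam_ne_zero z
  simp only [xV, thetaUnit]
  field_simp

/-- The coefficient of `X ^ m` in the `k`-th power of a series with coefficients `c`. -/
def powCoeff {R : Type*} [CommRing R] (c : ℕ → R) : ℕ → ℕ → R
  | 0, m => if m = 0 then 1 else 0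
  | k + 1, m => ∑ p ∈ Finset.HasAntidiagonal.antidiagonal m, powCoeff c k p.1 * c p.2

theorem coeff_pow_eq_powCoeff {R : Type*} [CommRing R] (H : Polynomial R) (k m : ℕ) :
    (H ^ k).coeff m = powCoeff H.coeff k m := by
  induction k generalizing m with
  | zero => simp [powCoeff, Polynomial.coeff_one]
  | succ k ih => simp [powCoeff, pow_succ, Polynomial.coeff_mul, ih]

theorem powCoeff_intCast (c : ℕ → ℤ) (k m : ℕ) :
    powCoeff (fun n ↦ (c n : ℂ)) k m = (powCoeff c k m : ℤ) := by
  induction k generalizing m with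
  | zero => simp [powCoeff]
  | succ k ih => simp [powCoeff, ih]

theorem tendsto_powCoeff {ι : Type*} {l : Filter ι} {c : ι → ℕ → ℂ} {c₀ : ℕ → ℂ}
    (hc : ∀ n, Tendsto (fun i ↦ c i n) l (𝓝 (c₀ n))) (k m : ℕ) :
    Tendsto (fun i ↦ powCoeff (c i) k m) l (𝓝 (powCoeff c₀ k m)) := by
  induction k generalizing m with
  | zero => exact tendsto_const_nhds
  | succ k ih => exact tendsto_finsetSum _ fun p _ ↦ (ih p.1).mul (hc p.2)

/-- The extension of a finite family by zero. -/
def extendZero {R : Type*} [Zero R] {N : ℕ} (c : Fin N → R) (n : ℕ) : R :=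
  if h : n < N then c ⟨n, h⟩ else 0

theorem coeff_sum_fin {N : ℕ} (h : Fin N → ℂ) :
    (∑ n : Fin N, Polynomial.C (h n) * Polynomial.X ^ (n : ℕ)).coeff = extendZero h := by
  ext m
  simp only [Polynomial.finsetSum_coeff, Polynomial.coeff_C_mul_X_pow, extendZero]
  split_ifs with hm
  · rw [Finset.sum_eq_single ⟨m, hm⟩]
    · simp
    · intro b _ hb
      rw [if_neg]
      rintro rfl
      exact hb rfl
    · simp
  · refine Finset.sum_eq_zero fun b _ ↦ if_neg ?_
    rintro rfl
    exact hm b.2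

theorem sum_zeta_pow (j : ℕ) :
    ∑ ν ∈ Finset.range 13, ζ ^ (j * ν) = if 13 ∣ j then 13 else 0 := by
  have hprim : IsPrimitiveRoot ζ 13 := Complex.isPrimitiveRoot_exp 13 (by norm_num)
  simp only [pow_mul]
  split_ifs with hj
  · simp [(hprim.pow_eq_one_iff_dvd j).2 hj]
  · have h1 : ζ ^ j ≠ 1 := fun h ↦ hj ((hprim.pow_eq_one_iff_dvd j).1 h)
    rw [geom_sum_eq h1, ← pow_mul, mul_comm, pow_mul, hprim.pow_eq_one, one_pow, sub_self, zero_div]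

theorem sum_zeta_mul_pow (h : Fin 13 → ℂ) (k e : ℕ) (u : ℂ) :
    ∑ ν ∈ Finset.range 13, ζ ^ (e * ν) * (∑ n, h n * (ζ ^ ν * u) ^ (n : ℕ)) ^ k =
      ∑ j ∈ Finset.range (12 * k + 1), if 13 ∣ e + j then
        13 * (powCoeff (extendZero h) k j * u ^ j) else 0 := by
  set H : Polynomial ℂ := ∑ n : Fin 13, Polynomial.C (h n) * Polynomial.X ^ (n : ℕ) with hH
  have hdeg : (H ^ k).natDegree < 12 * k + 1 := by
    have : H.natDegree ≤ 12 := Polynomial.natDegree_sum_le_of_forall_le _ _ fun n _ ↦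
      (Polynomial.natDegree_C_mul_X_pow_le _ _).trans (by omega)
    have := Polynomial.natDegree_pow_le_of_le k this
    omega
  have heval (x : ℂ) : (∑ n, h n * x ^ (n : ℕ)) ^ k =
      ∑ j ∈ Finset.range (12 * k + 1), powCoeff (extendZero h) k j * x ^ j := by
    rw [← coeff_sum_fin]
    simp only [← coeff_pow_eq_powCoeff]
    rw [← Polynomial.eval_eq_sum_range' hdeg]
    simp [hH, Polynomial.eval_finsetSum]
  simp only [heval, Finset.mul_sum]
  rw [Finset.sum_comm]
  refine Finset.sum_congr rfl fun j _ ↦ ?_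
  have := sum_zeta_pow (e + j)
  calc _ = (∑ ν ∈ Finset.range 13, ζ ^ ((e + j) * ν)) * (powCoeff (extendZero h) k j * u ^ j) := by
        rw [Finset.sum_mul]
        refine Finset.sum_congr rfl fun ν _ ↦ ?_
        rw [mul_pow, ← pow_mul]
        ring
    _ = _ := by
        rw [this]
        split_ifs <;> simp

theorem tendsto_sum_zeta_mul_pow {ι : Type*} {l : Filter ι} {u : ι → ℂ} (hu : Tendsto u l (𝓝 0))
    (hu0 : ∀ i, u i ≠ 0) {h : ι → Fin 13 → ℂ} {c : Fin 13 → ℤ}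
    (hc : Tendsto h l (𝓝 fun n ↦ (c n : ℂ))) {k e m : ℕ} (hm : m < 13) (hmk : m ≤ 12 * k)
    (he : 13 ∣ e + m) :
    Tendsto (fun i ↦ (∑ ν ∈ Finset.range 13,
      ζ ^ (e * ν) * (∑ n, h i n * (ζ ^ ν * u i) ^ (n : ℕ)) ^ k) / u i ^ m) l
      (𝓝 (13 * (powCoeff (extendZero c) k m : ℤ))) := by
  have hcoeff (n : ℕ) : Tendsto (fun i ↦ extendZero (h i) n) l (𝓝 (extendZero c n : ℤ)) := by
    unfold extendZero
    split_ifs with hn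
    · exact tendsto_pi_nhds.1 hc _
    · simp only [Int.cast_zero]
      exact tendsto_const_nhds
  have hterm (j : ℕ) : Tendsto (fun i ↦ (if 13 ∣ e + j then
      13 * (powCoeff (extendZero (h i)) k j * u i ^ j) else 0) / u i ^ m) l
      (𝓝 (if j = m then 13 * (powCoeff (extendZero c) k m : ℤ) else 0)) := by
    have hp := tendsto_powCoeff hcoeff k j
    rw [powCoeff_intCast] at hp
    by_cases hj : 13 ∣ e + j
    · have hmj : m ≤ j := by omega
      obtain ⟨d, rfl⟩ := Nat.exists_eq_add_of_le hmj
      have hq := (hp.const_mul 13).mul (hu.pow d)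
      simp only [if_pos hj]
      convert hq using 2
      · rw [pow_add]
        field_simp [hu0]
      · rcases Nat.eq_zero_or_pos d with rfl | hd
        · simp
        · rw [if_neg (by omega), zero_pow hd.ne', mul_zero]
    · rw [if_neg (by rintro rfl; exact hj he)]
      simp only [if_neg hj, zero_div]
      exact tendsto_const_nhds
  have := tendsto_finsetSum (Finset.range (12 * k + 1)) fun j _ ↦ hterm j
  rw [Finset.sum_ite_eq' , if_pos (Finset.mem_range.2 (by omega))] at this
  refine this.congr fun i ↦ ?_
  rw [sum_zeta_mul_pow, Finset.sum_div]

/-- The quadratic forms with their leading powers of the local parameter removed. -/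
@[irreducible] def quadUnit (t : ℂ) (β : Fin 6 → ℂ) : Fin 7 → ℂ :=
  ![t * β 0 * β 3 + t * β 1 * β 4 + β 2 * β 5,
    t ^ 2 * β 0 ^ 2 - 2 * β 2 * β 3,
    -t * β 4 ^ 2 - 2 * β 1 * β 3,
    β 1 ^ 2 - 2 * t * β 0 * β 4,
    β 2 ^ 2 - 2 * β 1 * β 5,
    -β 3 ^ 2 - 2 * t * β 0 * β 5,
    -β 5 ^ 2 - 2 * t * β 2 * β 4]

/-- The cubic forms with their leading powers of the local parameter removed. -/
@[irreducible] def cubicUnit (t : ℂ) (β : Fin 6 → ℂ) : Fin 14 → ℂ :=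
  ![β 0 * β 1 * β 2,
    2 * β 1 * β 2 ^ 2 + β 1 ^ 2 * β 5 - β 3 ^ 2 * β 4 + t * β 0 * β 4 * β 5,
    -β 5 ^ 3 + t * β 1 ^ 2 * β 3 - 2 * t ^ 2 * β 1 * β 4 ^ 2 + t ^ 2 * β 0 * β 3 * β 4 + 3 * t * β
    2 * β 4 * β 5,
    2 * t ^ 2 * β 0 * β 1 ^ 2 + t ^ 3 * β 0 ^ 2 * β 4 - β 3 * β 5 ^ 2 + t * β 2 * β 3 * β 4,
    -t * β 1 ^ 2 * β 2 + t * β 0 * β 5 ^ 2 - 2 * β 3 ^ 2 * β 5 - t ^ 2 * β 0 * β 2 * β 4,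
    -β 3 ^ 3 + t * β 2 ^ 2 * β 4 - 2 * β 2 * β 5 ^ 2 + t * β 1 * β 4 * β 5 + 3 * t * β 0 * β 3 * β
    5,
    -t ^ 2 * β 4 ^ 3 + t ^ 2 * β 0 ^ 2 * β 5 - 2 * t * β 0 * β 3 ^ 2 + β 2 * β 3 * β 5 + 3 * t * β
    1 * β 3 * β 4,
    -t * β 1 ^ 3 + β 2 * β 3 ^ 2 - t * β 0 * β 2 * β 5 - 3 * t ^ 2 * β 0 * β 1 * β 4 + 2 * t ^ 2 *
    β 0 ^ 2 * β 3,
    -t ^ 3 * β 0 ^ 3 + β 1 * β 5 ^ 2 - t * β 1 * β 2 * β 4 - 3 * t * β 0 * β 2 * β 3 + 2 * β 2 ^ 2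
    * β 5,
    2 * t ^ 2 * β 0 ^ 2 * β 2 + β 2 ^ 2 * β 3 - t * β 4 ^ 2 * β 5 + β 1 * β 3 * β 5,
    -t * β 0 * β 2 ^ 2 + β 1 * β 3 ^ 2 - 2 * t * β 3 * β 4 ^ 2 - t * β 0 * β 1 * β 5,
    -β 2 ^ 3 + t ^ 2 * β 0 * β 4 ^ 2 - t * β 0 * β 1 * β 3 - 3 * β 1 * β 2 * β 5 + 2 * t * β 1 ^ 2
    * β 4,
    -t ^ 2 * β 0 ^ 2 * β 1 + t * β 2 * β 4 ^ 2 - 2 * β 4 * β 5 ^ 2 - β 1 * β 2 * β 3,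
    β 3 * β 4 * β 5]

/-- The sextic forms, in the order of their leading exponents, with their leading powers of the
local parameter removed. -/
@[irreducible] def sexticUnit (t : ℂ) (d : Fin 14 → ℂ) : Fin 13 → ℂ :=
  ![-d 2 ^ 2 + 10 * t ^ 2 * d 0 * d 4 - 2 * t * d 13 * d 4 + 2 * t * d 5 * d 12 - 2 * t * d 9 * d
    8 - 4 * t * d 1 * d 3 - 2 * t * d 10 * d 7,
    -2 * t * d 9 ^ 2 - 4 * t ^ 2 * d 0 * d 5 + 6 * t * d 13 * d 5 - 2 * t * d 10 * d 8 + 2 * t * d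
    6 * d 12 - 2 * d 2 * d 3 - 2 * t * d 11 * d 7,
    -2 * d 3 ^ 2 - 4 * t ^ 2 * d 0 * d 6 + 6 * t * d 13 * d 6 - 2 * t * d 12 * d 7 + 2 * d 2 * d 4
    - 2 * t * d 5 * d 1 - 2 * t * d 8 * d 11,
    -2 * t * d 10 ^ 2 + 6 * t ^ 2 * d 0 * d 7 + 4 * t * d 13 * d 7 - 2 * t * d 1 * d 6 - 2 * d 2 *
    d 5 - 2 * t * d 8 * d 12 - 2 * t * d 9 * d 11,
    -2 * d 4 ^ 2 + 6 * t ^ 2 * d 0 * d 8 + 4 * t * d 13 * d 8 - 2 * d 3 * d 5 - 2 * d 6 * d 2 - 2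
    * t * d 11 * d 10 - 2 * t * d 1 * d 7,
    -t * d 11 ^ 2 + 2 * t ^ 2 * d 0 * d 9 + 10 * t * d 13 * d 9 + 2 * d 5 * d 4 - 2 * t * d 1 * d
    8 - 4 * t * d 10 * d 12 - 2 * d 3 * d 6,
    -d 5 ^ 2 + 10 * t ^ 2 * d 0 * d 10 - 2 * t * d 13 * d 10 + 2 * d 6 * d 4 - 2 * d 3 * d 7 - 4 *
    t * d 9 * d 1 - 2 * t * d 12 * d 11,
    -2 * t * d 12 ^ 2 + 6 * t ^ 2 * d 0 * d 11 + 4 * t * d 13 * d 11 - 2 * d 9 * d 2 - 2 * d 5 * d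
    6 - 2 * d 7 * d 4 - 2 * d 3 * d 8,
    -d 6 ^ 2 + 10 * t ^ 2 * d 0 * d 12 - 2 * t * d 13 * d 12 + 2 * d 2 * d 10 - 2 * t * d 1 * d 11
    - 4 * d 3 * d 9 - 2 * d 4 * d 8,
    -13 * t * (t ^ 2 * d 0 ^ 2 + d 13 ^ 2),
    -d 7 ^ 2 + 2 * t ^ 2 * d 0 * d 1 + 10 * t * d 13 * d 1 + 2 * d 2 * d 12 - 2 * d 3 * d 11 - 4 *
    d 4 * d 10 - 2 * d 9 * d 5,
    -2 * t * d 1 ^ 2 - 4 * t * d 0 * d 2 + 6 * d 13 * d 2 - 2 * d 4 * d 11 + 2 * d 5 * d 10 - 2 *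
    d 6 * d 9 - 2 * d 7 * d 8,
    -d 8 ^ 2 + 2 * t * d 0 * d 3 + 10 * d 13 * d 3 + 2 * d 6 * d 10 - 2 * d 9 * d 7 - 4 * d 12 * d
    4 - 2 * d 1 * d 2]

section

variable (u : ℂ) (β : Fin 6 → ℂ)

theorem AA0_leading : AA0 (fun i ↦ u ^ thetaExp i * β i) = u ^ 3 * quadUnit (u ^ 13) β 0 := by
  simp only [AA0, thetaExp, quadUnit, Matrix.cons_val]
  ring

theorem AA1_leading : AA1 (fun i ↦ u ^ thetaExp i * β i) = u ^ 4 * quadUnit (u ^ 13) β 1 := by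
  simp only [AA1, thetaExp, quadUnit, Matrix.cons_val]
  ring

theorem AA2_leading : AA2 (fun i ↦ u ^ thetaExp i * β i) = u ^ 7 * quadUnit (u ^ 13) β 2 := by
  simp only [AA2, thetaExp, quadUnit, Matrix.cons_val]
  ring

theorem AA3_leading : AA3 (fun i ↦ u ^ thetaExp i * β i) = u ^ 12 * quadUnit (u ^ 13) β 3 := by
  simp only [AA3, thetaExp, quadUnit, Matrix.cons_val]
  ring

theorem AA4_leading : AA4 (fun i ↦ u ^ thetaExp i * β i) = u ^ 6 * quadUnit (u ^ 13) β 4 := by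
  simp only [AA4, thetaExp, quadUnit, Matrix.cons_val]
  ring

theorem AA5_leading : AA5 (fun i ↦ u ^ thetaExp i * β i) = u ^ 2 * quadUnit (u ^ 13) β 5 := by
  simp only [AA5, thetaExp, quadUnit, Matrix.cons_val]
  ring

theorem AA6_leading : AA6 (fun i ↦ u ^ thetaExp i * β i) = quadUnit (u ^ 13) β 6 := by
  simp only [AA6, thetaExp, quadUnit, Matrix.cons_val]
  ring

theorem DD0_leading : DD0 (fun i ↦ u ^ thetaExp i * β i) = u ^ 24 * cubicUnit (u ^ 13) β 0 := by
  simp only [DD0, thetaExp, cubicUnit, Matrix.cons_val]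
  ring

theorem DD1_leading : DD1 (fun i ↦ u ^ thetaExp i * β i) = u ^ 12 * cubicUnit (u ^ 13) β 1 := by
  simp only [DD1, thetaExp, cubicUnit, Matrix.cons_val]
  ring

theorem DD2_leading : DD2 (fun i ↦ u ^ thetaExp i * β i) = cubicUnit (u ^ 13) β 2 := by
  simp only [DD2, thetaExp, cubicUnit, Matrix.cons_val]
  ring

theorem DD3_leading : DD3 (fun i ↦ u ^ thetaExp i * β i) = u * cubicUnit (u ^ 13) β 3 := by
  simp only [DD3, thetaExp, cubicUnit, Matrix.cons_val]
  ring

theorem DD4_leading : DD4 (fun i ↦ u ^ thetaExp i * β i) = u ^ 2 * cubicUnit (u ^ 13) β 4 := by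
  simp only [DD4, thetaExp, cubicUnit, Matrix.cons_val]
  ring

theorem DD5_leading : DD5 (fun i ↦ u ^ thetaExp i * β i) = u ^ 3 * cubicUnit (u ^ 13) β 5 := by
  simp only [DD5, thetaExp, cubicUnit, Matrix.cons_val]
  ring

theorem DD6_leading : DD6 (fun i ↦ u ^ thetaExp i * β i) = u ^ 4 * cubicUnit (u ^ 13) β 6 := by
  simp only [DD6, thetaExp, cubicUnit, Matrix.cons_val]
  ring

theorem DD7_leading : DD7 (fun i ↦ u ^ thetaExp i * β i) = u ^ 5 * cubicUnit (u ^ 13) β 7 := by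
  simp only [DD7, thetaExp, cubicUnit, Matrix.cons_val]
  ring

theorem DD8_leading : DD8 (fun i ↦ u ^ thetaExp i * β i) = u ^ 6 * cubicUnit (u ^ 13) β 8 := by
  simp only [DD8, thetaExp, cubicUnit, Matrix.cons_val]
  ring

theorem DD9_leading : DD9 (fun i ↦ u ^ thetaExp i * β i) = u ^ 7 * cubicUnit (u ^ 13) β 9 := by
  simp only [DD9, thetaExp, cubicUnit, Matrix.cons_val]
  ring

theorem DD10_leading : DD10 (fun i ↦ u ^ thetaExp i * β i) = u ^ 8 * cubicUnit (u ^ 13) β 10 := by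
  simp only [DD10, thetaExp, cubicUnit, Matrix.cons_val]
  ring

theorem DD11_leading : DD11 (fun i ↦ u ^ thetaExp i * β i) = u ^ 9 * cubicUnit (u ^ 13) β 11 := by
  simp only [DD11, thetaExp, cubicUnit, Matrix.cons_val]
  ring

theorem DD12_leading : DD12 (fun i ↦ u ^ thetaExp i * β i) = u ^ 10 * cubicUnit (u ^ 13) β 12 := by
  simp only [DD12, thetaExp, cubicUnit, Matrix.cons_val]
  ring

theorem DDinf_leading : DDinf (fun i ↦ u ^ thetaExp i * β i) = u ^ 11
    * cubicUnit (u ^ 13) β 13 := by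
  simp only [DDinf, thetaExp, cubicUnit, Matrix.cons_val]
  ring

theorem GG4_leading : GG4 (fun i ↦ u ^ thetaExp i * β i) = sexticUnit (u ^ 13) (cubicUnit (u ^ 13)
    β) 0 := by
  rw [GG4, DD0_leading, DD1_leading, DD2_leading, DD3_leading, DD4_leading, DD5_leading,
    DD7_leading, DD8_leading, DD9_leading, DD10_leading, DD12_leading, DDinf_leading, sexticUnit]
  simp only [Matrix.cons_val]
  ring

theorem GG5_leading : GG5 (fun i ↦ u ^ thetaExp i * β i) = u
    * sexticUnit (u ^ 13) (cubicUnit (u ^ 13) β) 1 := by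
  rw [GG5, DD0_leading, DD2_leading, DD3_leading, DD5_leading, DD6_leading, DD7_leading,
    DD8_leading, DD9_leading, DD10_leading, DD11_leading, DD12_leading, DDinf_leading, sexticUnit]
  simp only [Matrix.cons_val]
  ring

theorem GG6_leading : GG6 (fun i ↦ u ^ thetaExp i * β i) = u ^ 2
    * sexticUnit (u ^ 13) (cubicUnit (u ^ 13) β) 2 := by
  rw [GG6, DD0_leading, DD1_leading, DD2_leading, DD3_leading, DD4_leading, DD5_leading,
    DD6_leading, DD7_leading, DD8_leading, DD11_leading, DD12_leading, DDinf_leading, sexticUnit]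
  simp only [Matrix.cons_val]
  ring

theorem GG7_leading : GG7 (fun i ↦ u ^ thetaExp i * β i) = u ^ 3
    * sexticUnit (u ^ 13) (cubicUnit (u ^ 13) β) 3 := by
  rw [GG7, DD0_leading, DD1_leading, DD2_leading, DD5_leading, DD6_leading, DD7_leading,
    DD8_leading, DD9_leading, DD10_leading, DD11_leading, DD12_leading, DDinf_leading, sexticUnit]
  simp only [Matrix.cons_val]
  ring

theorem GG8_leading : GG8 (fun i ↦ u ^ thetaExp i * β i) = u ^ 4
    * sexticUnit (u ^ 13) (cubicUnit (u ^ 13) β) 4 := by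
  rw [GG8, DD0_leading, DD1_leading, DD2_leading, DD3_leading, DD4_leading, DD5_leading,
    DD6_leading, DD7_leading, DD8_leading, DD10_leading, DD11_leading, DDinf_leading, sexticUnit]
  simp only [Matrix.cons_val]
  ring

theorem GG9_leading : GG9 (fun i ↦ u ^ thetaExp i * β i) = u ^ 5
    * sexticUnit (u ^ 13) (cubicUnit (u ^ 13) β) 5 := by
  rw [GG9, DD0_leading, DD1_leading, DD3_leading, DD4_leading, DD5_leading, DD6_leading,
    DD8_leading, DD9_leading, DD10_leading, DD11_leading, DD12_leading, DDinf_leading, sexticUnit]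
  simp only [Matrix.cons_val]
  ring

theorem GG10_leading : GG10 (fun i ↦ u ^ thetaExp i * β i) = u ^ 6
    * sexticUnit (u ^ 13) (cubicUnit (u ^ 13) β) 6 := by
  rw [GG10, DD0_leading, DD1_leading, DD3_leading, DD4_leading, DD5_leading, DD6_leading,
    DD7_leading, DD9_leading, DD10_leading, DD11_leading, DD12_leading, DDinf_leading, sexticUnit]
  simp only [Matrix.cons_val]
  ring

theorem GG11_leading : GG11 (fun i ↦ u ^ thetaExp i * β i) = u ^ 7
    * sexticUnit (u ^ 13) (cubicUnit (u ^ 13) β) 7 := by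
  rw [GG11, DD0_leading, DD2_leading, DD3_leading, DD4_leading, DD5_leading, DD6_leading,
    DD7_leading, DD8_leading, DD9_leading, DD11_leading, DD12_leading, DDinf_leading, sexticUnit]
  simp only [Matrix.cons_val]
  ring

theorem GG12_leading : GG12 (fun i ↦ u ^ thetaExp i * β i) = u ^ 8
    * sexticUnit (u ^ 13) (cubicUnit (u ^ 13) β) 8 := by
  rw [GG12, DD0_leading, DD1_leading, DD2_leading, DD3_leading, DD4_leading, DD6_leading,
    DD8_leading, DD9_leading, DD10_leading, DD11_leading, DD12_leading, DDinf_leading, sexticUnit]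
  simp only [Matrix.cons_val]
  ring

theorem GG1_leading : GG1 (fun i ↦ u ^ thetaExp i * β i) = u ^ 10
    * sexticUnit (u ^ 13) (cubicUnit (u ^ 13) β) 10 := by
  rw [GG1, DD0_leading, DD1_leading, DD2_leading, DD3_leading, DD4_leading, DD5_leading,
    DD7_leading, DD9_leading, DD10_leading, DD11_leading, DD12_leading, DDinf_leading, sexticUnit]
  simp only [Matrix.cons_val]
  ring

theorem GG2_leading : GG2 (fun i ↦ u ^ thetaExp i * β i) = u ^ 11
    * sexticUnit (u ^ 13) (cubicUnit (u ^ 13) β) 11 := by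
  rw [GG2, DD0_leading, DD1_leading, DD2_leading, DD4_leading, DD5_leading, DD6_leading,
    DD7_leading, DD8_leading, DD9_leading, DD10_leading, DD11_leading, DDinf_leading, sexticUnit]
  simp only [Matrix.cons_val]
  ring

theorem GG3_leading : GG3 (fun i ↦ u ^ thetaExp i * β i) = u ^ 12
    * sexticUnit (u ^ 13) (cubicUnit (u ^ 13) β) 12 := by
  rw [GG3, DD0_leading, DD1_leading, DD2_leading, DD3_leading, DD4_leading, DD6_leading,
    DD7_leading, DD8_leading, DD9_leading, DD10_leading, DD12_leading, DDinf_leading, sexticUnit]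
  simp only [Matrix.cons_val]
  ring

theorem GG0_leading : -13 * GG0 (fun i ↦ u ^ thetaExp i * β i) =
    u ^ 9 * sexticUnit (u ^ 13) (cubicUnit (u ^ 13) β) 9 := by
  rw [GG0, DD0_leading, DDinf_leading, sexticUnit]
  simp only [Matrix.cons_val]
  ring

/-- The coefficients of the quadratic forms, in the order of their leading exponents. -/
def quadCoeff (a : Fin 7 → ℂ) : Fin 13 → ℂ :=
  ![a 6, 0, a 5, a 0, a 1, 0, a 4, a 2, 0, 0, 0, 0, a 3]

theorem sum_fin_thirteen (f : Fin 13 → ℂ) : ∑ n, f n = f 0 + f 1 + f 2 + f 3 + f 4 + f 5 + f 6 +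
    f 7 + f 8 + f 9 + f 10 + f 11 + f 12 := by
  simp only [Fin.sum_univ_castSucc, Fin.sum_univ_zero, zero_add]
  rfl

theorem dF_leading (ν : ℕ) : dF ν (fun i ↦ u ^ thetaExp i * β i) =
    ζ ^ (4 * ν) * ∑ n, sexticUnit (u ^ 13) (cubicUnit (u ^ 13) β) n * (ζ ^ ν * u) ^ (n : ℕ) := by
  have h13 : (ζ ^ ν) ^ 13 = 1 := by rw [← pow_mul, mul_comm, pow_mul, zeta_pow_thirteen, one_pow]
  simp only [dF, GG0_leading, GG1_leading, GG2_leading, GG3_leading, GG4_leading, GG5_leading,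
    GG6_leading, GG7_leading, GG8_leading, GG9_leading, GG10_leading, GG11_leading, GG12_leading]
  generalize sexticUnit (u ^ 13) (cubicUnit (u ^ 13) β) = g
  simp only [mul_comm _ ν, pow_mul, sum_fin_thirteen]
  generalize ζ ^ ν = s at h13 ⊢
  norm_num
  linear_combination -(u ^ 9 * g 9 + s * u ^ 10 * g 10 + s ^ 2 * u ^ 11 * g 11 +
    s ^ 3 * u ^ 12 * g 12) * h13

theorem wF_leading (ν : ℕ) : wF ν (fun i ↦ u ^ thetaExp i * β i) =
    (ζ ^ (10 * ν) * ∑ n, quadCoeff (quadUnit (u ^ 13) β) n * (ζ ^ ν * u) ^ (n : ℕ)) ^ 2 := by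
  have h13 : (ζ ^ ν) ^ 13 = 1 := by rw [← pow_mul, mul_comm, pow_mul, zeta_pow_thirteen, one_pow]
  simp only [wF, AA0_leading, AA1_leading, AA2_leading, AA3_leading, AA4_leading, AA5_leading,
    AA6_leading]
  generalize quadUnit (u ^ 13) β = a
  simp only [mul_comm _ ν, pow_mul, sum_fin_thirteen, quadCoeff, Matrix.cons_val]
  generalize ζ ^ ν = s at h13 ⊢
  congr 1
  norm_num
  linear_combination -(u ^ 3 * a 0 + s * u ^ 4 * a 1 + s ^ 3 * u ^ 6 * a 4 + s ^ 4 * u ^ 7 * a 2 +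
    s ^ 9 * u ^ 12 * a 3) * h13

theorem dInf_leading : dInf (fun i ↦ u ^ thetaExp i * β i) =
    -13 * (u ^ 9 * sexticUnit (u ^ 13) (cubicUnit (u ^ 13) β) 9) := by
  rw [← GG0_leading, dInf]
  ring

theorem wInf_leading : wInf (fun i ↦ u ^ thetaExp i * β i) =
    13 * (u ^ 3 * quadUnit (u ^ 13) β 0) ^ 2 := by
  rw [wInf, AA0_leading]

end

theorem continuous_quadUnit : Continuous fun p : ℂ × (Fin 6 → ℂ) ↦ quadUnit p.1 p.2 := by
  refine continuous_pi fun i ↦ ?_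
  fin_cases i <;> simp only [quadUnit] <;> fun_prop

theorem continuous_cubicUnit : Continuous fun p : ℂ × (Fin 6 → ℂ) ↦ cubicUnit p.1 p.2 := by
  refine continuous_pi fun i ↦ ?_
  fin_cases i <;> simp only [cubicUnit] <;> fun_prop

theorem continuous_sexticUnit : Continuous fun p : ℂ × (Fin 14 → ℂ) ↦ sexticUnit p.1 p.2 := by
  refine continuous_pi fun i ↦ ?_
  fin_cases i <;> simp only [sexticUnit] <;> fun_prop

theorem quadUnit_zero : quadUnit 0 thetaSign = ![1, 2, 2, 1, -1, -1, -1] := by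
  ext i
  fin_cases i <;> simp [quadUnit, thetaSign]
  norm_num

theorem cubicUnit_zero :
    cubicUnit 0 thetaSign = ![1, 2, -1, 1, -2, -1, -1, 1, 3, -2, 1, -4, -1, -1] := by
  ext i
  fin_cases i <;> simp [cubicUnit, thetaSign] <;> norm_num

theorem sexticUnit_zero : sexticUnit 0 (cubicUnit 0 thetaSign) =
    ![-1, 2, 2, -2, -8, 6, 1, -8, 17, 0, 13, -22, -21] := by
  rw [cubicUnit_zero]
  ext i
  fin_cases i <;> simp [sexticUnit] <;> norm_num

/-- The vector of theta constants divided by `q ^ (1 / 104)`. -/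
def cuspVec (z : ℂ) (i : Fin 6) : ℂ := cuspParam z ^ thetaExp i * thetaUnit z i

theorem tendsto_cuspParam_pow {n : ℕ} (hn : n ≠ 0) :
    Tendsto (fun z ↦ cuspParam z ^ n) atCusp (𝓝 0) := by
  simpa [hn] using tendsto_cuspParam.pow n

/-- The leading coefficients of the quadratic forms. -/
def quadLead : Fin 13 → ℤ := ![-1, 0, -1, 1, 2, 0, -1, 2, 0, 0, 0, 0, 1]

/-- The leading coefficients of the sextic forms. -/
def sexticLead : Fin 13 → ℤ := ![-1, 2, 2, -2, -8, 6, 1, -8, 17, 0, 13, -22, -21]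

theorem tendsto_quadUnit : Tendsto (fun z ↦ quadUnit (cuspParam z ^ 13) (thetaUnit z)) atCusp
    (𝓝 ![1, 2, 2, 1, -1, -1, -1]) := by
  rw [← quadUnit_zero]
  exact (continuous_quadUnit.tendsto (0, thetaSign)).comp
    ((tendsto_cuspParam_pow (by norm_num)).prodMk_nhds tendsto_thetaUnit)

theorem tendsto_quadCoeff :
    Tendsto (fun z ↦ quadCoeff (quadUnit (cuspParam z ^ 13) (thetaUnit z))) atCusp
      (𝓝 fun n ↦ (quadLead n : ℂ)) := by
  have h : Continuous quadCoeff := by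
    refine continuous_pi fun i ↦ ?_
    fin_cases i <;> simp only [quadCoeff] <;> fun_prop
  have h' : quadCoeff ![1, 2, 2, 1, -1, -1, -1] = fun n ↦ (quadLead n : ℂ) := by
    ext i
    fin_cases i <;> simp [quadCoeff, quadLead]
  rw [← h']
  exact (h.tendsto _).comp tendsto_quadUnit

theorem tendsto_sexticUnit :
    Tendsto (fun z ↦ sexticUnit (cuspParam z ^ 13) (cubicUnit (cuspParam z ^ 13) (thetaUnit z)))
      atCusp (𝓝 fun n ↦ (sexticLead n : ℂ)) := by
  have h : sexticUnit 0 (cubicUnit 0 thetaSign) = fun n ↦ (sexticLead n : ℂ) := by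
    rw [sexticUnit_zero]
    ext i
    fin_cases i <;> simp [sexticLead]
  have h0 := tendsto_cuspParam_pow (n := 13) (by norm_num)
  rw [← h]
  exact (continuous_sexticUnit.tendsto (0, cubicUnit 0 thetaSign)).comp
    (h0.prodMk_nhds ((continuous_cubicUnit.tendsto (0, thetaSign)).comp
      (h0.prodMk_nhds tendsto_thetaUnit)))

theorem tendsto_dSum_cuspVec {k m : ℕ} (hm : m < 13) (hmk : m < 9 * k) (h : 13 ∣ 4 * k + m) :
    Tendsto (fun z ↦ dSum k (cuspVec z) / cuspParam z ^ m) atCusp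
      (𝓝 (13 * (powCoeff (extendZero sexticLead) k m : ℤ))) := by
  have h₁ := tendsto_sum_zeta_mul_pow tendsto_cuspParam cuspParam_ne_zero tendsto_sexticUnit hm
    (show m ≤ 12 * k by omega) h
  have h₂ := ((tendsto_pi_nhds.1 tendsto_sexticUnit 9).const_mul (-13)).pow k |>.mul
    (tendsto_cuspParam_pow (show 9 * k - m ≠ 0 by omega))
  rw [mul_zero] at h₂
  have h₃ := h₁.add h₂
  rw [add_zero] at h₃
  refine h₃.congr fun z ↦ ?_
  have hu := cuspParam_ne_zero z
  rw [dSum, add_div]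
  congr 1
  · congr 1
    refine Finset.sum_congr rfl fun ν _ ↦ ?_
    unfold cuspVec
    rw [dF_leading, mul_pow, ← pow_mul]
    congr 2
    ring
  · unfold cuspVec
    rw [dInf_leading, eq_div_iff (pow_ne_zero _ hu), mul_assoc, ← pow_add,
      Nat.sub_add_cancel hmk.le, mul_left_comm, mul_pow (cuspParam z ^ 9), ← pow_mul]
    ring

theorem tendsto_wSum_cuspVec {k m : ℕ} (hm : m < 13) (hmk : m < 6 * k) (h : 13 ∣ 20 * k + m) :
    Tendsto (fun z ↦ wSum k (cuspVec z) / cuspParam z ^ m) atCusp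
      (𝓝 (13 * (powCoeff (extendZero quadLead) (2 * k) m : ℤ))) := by
  have h₁ := tendsto_sum_zeta_mul_pow tendsto_cuspParam cuspParam_ne_zero tendsto_quadCoeff hm
    (show m ≤ 12 * (2 * k) by omega) h
  have h₂ := (((tendsto_pi_nhds.1 tendsto_quadUnit 0).pow 2).const_mul 13).pow k |>.mul
    (tendsto_cuspParam_pow (show 6 * k - m ≠ 0 by omega))
  rw [mul_zero] at h₂
  have h₃ := h₁.add h₂
  rw [add_zero] at h₃
  refine h₃.congr fun z ↦ ?_
  have hu := cuspParam_ne_zero z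
  rw [wSum, add_div]
  congr 1
  · congr 1
    refine Finset.sum_congr rfl fun ν _ ↦ ?_
    unfold cuspVec
    rw [wF_leading, ← pow_mul, mul_pow, ← pow_mul]
    congr 2
    ring
  · unfold cuspVec
    rw [wInf_leading, eq_div_iff (pow_ne_zero _ hu), mul_assoc, ← pow_add,
      Nat.sub_add_cancel hmk.le, mul_pow (cuspParam z ^ 3), ← pow_mul, mul_left_comm,
      mul_pow (cuspParam z ^ (3 * 2)), ← pow_mul]
    ring

theorem gaussTerm_one_pow {a b m : ℕ} (h : 3 * a + 24 * m = 13 * b) (z : ℂ) :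
    gaussTerm 1 z ^ a * cuspParam z ^ m = cexp (2 * Real.pi * I * z / 24) ^ b := by
  rw [gaussTerm, cuspParam, ← Complex.exp_nat_mul, ← Complex.exp_nat_mul, ← Complex.exp_nat_mul,
    ← Complex.exp_add]
  congr 1
  have h' : (3 * a + 24 * m : ℂ) = 13 * b := mod_cast h
  push_cast
  linear_combination Real.pi * I * z / 156 * h'

theorem eventually_im_pos : ∀ᶠ z in atCusp, 0 < z.im :=
  preimage_mem_comap (eventually_gt_atTop 0)

/-- Compare a leading coefficient in the local parameter with a quotient by a power of `η`. -/
theorem tendsto_div_etaF_pow {f : ℂ → ℂ} {c : ℂ} {a b m : ℕ}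
    (hf : Tendsto (fun z ↦ f z / cuspParam z ^ m) atCusp (𝓝 c)) (h : 3 * a + 24 * m = 13 * b) :
    Tendsto (fun z ↦ (etaF z * gaussTerm 1 z) ^ a * f z / etaF z ^ (a + b)) atCusp (𝓝 c) := by
  have h₁ := hf.div (tendsto_eta_tprod.pow b) (by simp)
  rw [one_pow, div_one] at h₁
  refine h₁.congr' (eventually_im_pos.mono fun z hz ↦ ?_)
  have h₂ : etaF z = cexp (2 * Real.pi * I * z / 24) *
    ∏' n : ℕ, (1 - cexp (2 * Real.pi * I * z) ^ (n + 1)) := rfl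
  have h₃ := etaF_ne_zero hz
  have h₄ : (∏' n : ℕ, (1 - cexp (2 * Real.pi * I * z) ^ (n + 1))) ≠ 0 := fun h ↦
    h₃ (by rw [h₂, h, mul_zero])
  have h₅ := gaussTerm_one_pow h z
  have h₆ := cuspParam_ne_zero z
  have h₇ : etaF z ^ b = gaussTerm 1 z ^ a * cuspParam z ^ m *
      (∏' n : ℕ, (1 - cexp (2 * Real.pi * I * z) ^ (n + 1))) ^ b := by
    rw [h₅, ← mul_pow, ← h₂]
  have h₈ : gaussTerm 1 z ≠ 0 := Complex.exp_ne_zero _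
  simp only [Pi.div_apply]
  rw [pow_add, h₇, mul_pow]
  field_simp

theorem tendsto_dSum_xV {k m b : ℕ} (hm : m < 13) (hmk : m < 9 * k) (h : 13 ∣ 4 * k + m)
    (hb : 3 * (6 * k) + 24 * m = 13 * b) :
    Tendsto (fun z ↦ dSum k (xV z) / etaF z ^ (6 * k + b)) atCusp
      (𝓝 (13 * (powCoeff (extendZero sexticLead) k m : ℤ))) := by
  refine (tendsto_div_etaF_pow (tendsto_dSum_cuspVec hm hmk h) hb).congr fun z ↦ ?_
  rw [xV_eq_thetaUnit, dSum_smul]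
  rfl

theorem tendsto_wSum_xV {k m b : ℕ} (hm : m < 13) (hmk : m < 6 * k) (h : 13 ∣ 20 * k + m)
    (hb : 3 * (4 * k) + 24 * m = 13 * b) :
    Tendsto (fun z ↦ wSum k (xV z) / etaF z ^ (4 * k + b)) atCusp
      (𝓝 (13 * (powCoeff (extendZero quadLead) (2 * k) m : ℤ))) := by
  refine (tendsto_div_etaF_pow (tendsto_wSum_cuspVec hm hmk h) hb).congr fun z ↦ ?_
  rw [xV_eq_thetaUnit, wSum_smul]
  rfl

open ModularForm EisensteinSeries UpperHalfPlane MatrixGroups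

theorem dSum_xV_eq_modularForm {k n w : ℕ} (hw : w < 12) (hwk : w + 12 * n = 6 * k) {c : ℂ}
    (hc : c ≠ 0) (hlim : Tendsto (fun z ↦ dSum k (xV z) / etaF z ^ (24 * n)) atCusp (𝓝 c))
    (g : ModularForm 𝒮ℒ (w : ℤ)) (hg : Tendsto g atImInfty (𝓝 1)) (z : ℍ) :
    dSum k (xV z) = c * etaF z ^ (24 * n) * g z := by
  have hη {z : ℂ} (hz : 0 < z.im) : etaF z ^ (24 * n) ≠ 0 := pow_ne_zero _ (etaF_ne_zero hz)
  have key := eq_modularForm_of_tendsto (f := fun z ↦ dSum k (xV z) / etaF z ^ (24 * n) / c)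
    (by exact_mod_cast hw)
    (fun z hz ↦ ((differentiableAt_comp_xV (differentiable_dSum k) hz).div
      ((differentiableAt_etaF hz).pow _) (hη hz)).div_const c)
    (fun z _ ↦ by rw [dSum_xV_add_one, pow_mul, pow_mul, etaF_pow_twentyfour_add_one])
    (fun z hz ↦ by
      have hz0 : z ≠ 0 := by rintro rfl; simp at hz
      have h24 : etaF (-1 / z) ^ (24 * n) = z ^ (12 * n) * etaF z ^ (24 * n) := by
        rw [show 24 * n = 8 * (3 * n) by ring, pow_mul, etaF_neg_inv_pow_eight hz, mul_pow,
          ← pow_mul, ← pow_mul]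
        ring
      have := hη hz
      rw [dSum_xV_neg_inv k hz, h24, ← hwk, pow_add, zpow_natCast]
      field_simp)
    (by simpa only [div_self hc] using! hlim.div_const c) g hg z
  have := hη z.im_pos
  rw [← key]
  field_simp

theorem wSum_xV_eq_modularForm {k n w : ℕ} (hw : w < 12) (hwk : w + 4 * n = 4 * k)
    {d : ℕ} (hd : 20 * n = 4 * k + 3 * d) {c : ℂ} (hc : c ≠ 0)
    (hlim : Tendsto (fun z ↦ wSum k (xV z) / etaF z ^ (8 * n)) atCusp (𝓝 c))
    (g : ModularForm 𝒮ℒ (w : ℤ)) (hg : Tendsto g atImInfty (𝓝 1)) (z : ℍ) :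
    wSum k (xV z) = c * etaF z ^ (8 * n) * g z := by
  have hη {z : ℂ} (hz : 0 < z.im) : etaF z ^ (8 * n) ≠ 0 := pow_ne_zero _ (etaF_ne_zero hz)
  have h8 (z : ℂ) : etaF (z + 1) ^ (8 * n) =
      cexp (2 * Real.pi * Complex.I * (2 / 3)) ^ (4 * k) * etaF z ^ (8 * n) := by
    rw [pow_mul, etaF_pow_eight_add_one, mul_pow, ← pow_mul, hd, pow_add, pow_mul _ 3,
      cexp_two_thirds_pow_three, one_pow, mul_one, ← pow_mul]
  have key := eq_modularForm_of_tendsto (f := fun z ↦ wSum k (xV z) / etaF z ^ (8 * n) / c)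
    (by exact_mod_cast hw)
    (fun z hz ↦ ((differentiableAt_comp_xV (differentiable_wSum k) hz).div
      ((differentiableAt_etaF hz).pow _) (hη hz)).div_const c)
    (fun z _ ↦ by
      rw [wSum_xV_add_one, h8, mul_div_mul_left _ _ (pow_ne_zero _ (Complex.exp_ne_zero _))])
    (fun z hz ↦ by
      have hz0 : z ≠ 0 := by rintro rfl; simp at hz
      have h8 : etaF (-1 / z) ^ (8 * n) = z ^ (4 * n) * etaF z ^ (8 * n) := by
        rw [pow_mul, etaF_neg_inv_pow_eight hz, mul_pow, ← pow_mul, ← pow_mul]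
      have := hη hz
      rw [wSum_xV_neg_inv k hz, h8, ← hwk, pow_add, zpow_natCast]
      field_simp)
    (by simpa only [div_self hc] using! hlim.div_const c) g hg z
  have := hη z.im_pos
  rw [← key]
  field_simp

theorem Phi12_xV (z : ℍ) : Phi12 (xV z) = etaF z ^ 24 := by
  have h : powCoeff (extendZero sexticLead) 2 5 = -52 := by decide +kernel
  have := dSum_xV_eq_modularForm (k := 2) (n := 1) (w := 0) (by norm_num) (by norm_num) ?_
    (tendsto_dSum_xV (k := 2) (m := 5) (b := 12) (by norm_num) (by norm_num) (by norm_num)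
      (by norm_num)) (ModularForm.const 1) tendsto_const_nhds z
  · rw [show Phi12 (xV z) = -(1 / (13 * 52)) * dSum 2 (xV z) from rfl, this, h,
      ModularForm.const_apply]
    norm_num
    ring
  · rw [h]
    norm_num

theorem Phi18_xV (z : ℍ) : Phi18 (xV z) = etaF z ^ 24 * E₆ z := by
  have h : powCoeff (extendZero sexticLead) 3 1 = 6 := by decide +kernel
  have := dSum_xV_eq_modularForm (k := 3) (n := 1) (w := 6) (by norm_num) (by norm_num) ?_
    (tendsto_dSum_xV (k := 3) (m := 1) (b := 6) (by norm_num) (by norm_num) (by norm_num)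
      (by norm_num)) E₆ (tendsto_E_atImInfty (by norm_num) ⟨3, rfl⟩) z
  · rw [show Phi18 (xV z) = 1 / (13 * 6) * dSum 3 (xV z) from rfl, this, h]
    norm_num
    ring
  · rw [h]
    norm_num

theorem Phi30_xV (z : ℍ) : Phi30 (xV z) = etaF z ^ 48 * E₆ z := by
  have h : powCoeff (extendZero sexticLead) 5 6 = -1315 := by decide +kernel
  have := dSum_xV_eq_modularForm (k := 5) (n := 2) (w := 6) (by norm_num) (by norm_num) ?_
    (tendsto_dSum_xV (k := 5) (m := 6) (b := 18) (by norm_num) (by norm_num) (by norm_num)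
      (by norm_num)) E₆ (tendsto_E_atImInfty (by norm_num) ⟨3, rfl⟩) z
  · rw [show Phi30 (xV z) = -(1 / (13 * 1315)) * dSum 5 (xV z) from rfl, this, h]
    norm_num
    ring
  · rw [h]
    norm_num

theorem Phi20_xV (z : ℍ) : Phi20 (xV z) = etaF z ^ 32 * E₄ z := by
  have h : powCoeff (extendZero quadLead) 10 4 = 25 := by decide +kernel
  have := wSum_xV_eq_modularForm (n := 4) (w := 4) (k := 5) (d := 20) (by norm_num) (by norm_num)
    (by norm_num) ?_
    (tendsto_wSum_xV (k := 5) (m := 4) (b := 12) (by norm_num) (by norm_num) (by norm_num)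
      (by norm_num)) E₄ (tendsto_E_atImInfty (by norm_num) ⟨2, rfl⟩) z
  · rw [show Phi20 (xV z) = 1 / (13 * 25) * wSum 5 (xV z) from rfl, this, h]
    norm_num
    ring
  · rw [h]
    norm_num

theorem E₄_cube_sub_E₆_sq (z : ℍ) : E₄ z ^ 3 - E₆ z ^ 2 = 1728 * etaF z ^ 24 := by
  have := ModularForm.discriminant_eq_E₄_cube_sub_E₆_sq z
  rw [ModularForm.discriminant, ← etaF_eq_eta] at this
  rw [this]
  ring

end

theorem stmt14 (z : ℂ) (hz : 0 < z.im) :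
    (Phi20 (xV z)) ^ 3 - (Phi30 (xV z)) ^ 2 = 1728 * (Phi12 (xV z)) ^ 5 ∧
    (Phi20 (xV z)) ^ 3 - (Phi12 (xV z)) ^ 2 * (Phi18 (xV z)) ^ 2 = 1728 * (Phi12 (xV z)) ^ 5 := by
  lift z to UpperHalfPlane using hz
  rw [Phi12_xV, Phi18_xV, Phi20_xV, Phi30_xV]
  constructor <;> linear_combination etaF z ^ 96 * E₄_cube_sub_E₆_sq z
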